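/- arXiv:2005.04194 — 2 statements merged into one kernel-verified Lean document; each statement's English description precedes it below -/
import Mathlib

section
/- Let p > 3 be a prime with p ≡ 3 (mod 4) and let h be the class number of ℚ(√-p). Then the sum of the quadratic residues modulo p, taken with representatives between 1 and p-1, satisfies Σ_{1 ≤ a ≤ p-1, (a|p)=+1} a/p = (p-1)/4 - h/2. -/
section IntegralBasis

open Module

theorem leftMulMatrix_of_quadratic {R S : Type*} [CommRing R] [CommRing S] [Algebra R S]
    (b : Basis (Fin 2) R S) (h0 : b 0 = 1) {e c : R} (h1 : b 1 * b 1 = e • b 1 - c • b 0)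
    (u v : R) :
    Algebra.leftMulMatrix b (u • b 0 + v • b 1) = !![u, -(c * v); v, u + e * v] := by
  have e0 : (u • b 0 + v • b 1) * b 0 = u • b 0 + v • b 1 := by rw [h0, mul_one]
  have e1 : (u • b 0 + v • b 1) * b 1 = (-(c * v)) • b 0 + (u + e * v) • b 1 := by
    rw [add_mul, smul_mul_assoc, smul_mul_assoc, h1, h0, one_mul]
    module
  ext i j
  rw [Algebra.leftMulMatrix_eq_repr_mul]
  fin_cases j
  · fin_cases i <;> simp [e0]
  · fin_cases i <;> simp [e1]

theorem trace_of_quadratic {R S : Type*} [CommRing R] [CommRing S] [Algebra R S]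
    (b : Basis (Fin 2) R S) (h0 : b 0 = 1) {e c : R} (h1 : b 1 * b 1 = e • b 1 - c • b 0)
    (u v : R) : Algebra.trace R S (u • b 0 + v • b 1) = 2 * u + e * v := by
  rw [Algebra.trace_eq_matrix_trace b, leftMulMatrix_of_quadratic b h0 h1, Matrix.trace_fin_two_of]
  ring

theorem norm_of_quadratic {R S : Type*} [CommRing R] [CommRing S] [Algebra R S]
    (b : Basis (Fin 2) R S) (h0 : b 0 = 1) {e c : R} (h1 : b 1 * b 1 = e • b 1 - c • b 0)
    (u v : R) : Algebra.norm R (u • b 0 + v • b 1) = u ^ 2 + e * u * v + c * v ^ 2 := by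
  rw [Algebra.norm_eq_matrix_det b, leftMulMatrix_of_quadratic b h0 h1, Matrix.det_fin_two_of]
  ring

variable {K : Type*} [Field K] [NumberField K] {α : K} {p : ℕ}

theorem exists_eq_add_mul_of_adjoin_eq_top (hα : α ^ 2 = -(p : K))
    (hgen : Algebra.adjoin ℚ ({α} : Set K) = ⊤) (x : K) : ∃ s t : ℚ, x = s + t * α := by
  have hx : x ∈ Algebra.adjoin ℚ ({α} : Set K) := hgen ▸ Algebra.mem_top
  induction hx using Algebra.adjoin_induction with
  | mem x hx => exact ⟨0, 1, by simpa using hx⟩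
  | algebraMap r => exact ⟨r, 0, by simp⟩
  | add x y _ _ hx hy =>
    obtain ⟨s, t, rfl⟩ := hx
    obtain ⟨s', t', rfl⟩ := hy
    exact ⟨s + s', t + t', by push_cast; ring⟩
  | mul x y _ _ hx hy =>
    obtain ⟨s, t, rfl⟩ := hx
    obtain ⟨s', t', rfl⟩ := hy
    exact ⟨s * s' - p * (t * t'), s * t' + t * s', by push_cast; linear_combination (t * t' : K) * hα⟩

theorem eq_zero_of_add_mul_eq_zero (hα : α ^ 2 = -(p : K)) (hp : 0 < p) {s t : ℚ}
    (h : (s + t * α : K) = 0) : s = 0 ∧ t = 0 := by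
  have hK : ((s ^ 2 + p * t ^ 2 : ℚ) : K) = 0 := by
    push_cast
    linear_combination (s - t * α) * h + (t : K) ^ 2 * hα
  have hQ : s ^ 2 + p * t ^ 2 = 0 := by exact_mod_cast hK
  have hp' : (0 : ℚ) < p := by exact_mod_cast hp
  have ht : t = 0 := by
    by_contra ht
    have : 0 < p * t ^ 2 := by positivity
    nlinarith [sq_nonneg s]
  exact ⟨by simpa [ht] using hQ, ht⟩

theorem exists_basis_sqrt (hα : α ^ 2 = -(p : K)) (hp : 0 < p)
    (hgen : Algebra.adjoin ℚ ({α} : Set K) = ⊤) :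
    ∃ b : Basis (Fin 2) ℚ K, b 0 = 1 ∧ b 1 = α := by
  have hli : LinearIndependent ℚ ![(1 : K), α] := by
    rw [LinearIndependent.pair_iff]
    intro s t h
    exact eq_zero_of_add_mul_eq_zero hα hp (by simpa [Algebra.smul_def] using h)
  have hsp : ⊤ ≤ Submodule.span ℚ (Set.range ![(1 : K), α]) := by
    intro x _
    obtain ⟨s, t, rfl⟩ := exists_eq_add_mul_of_adjoin_eq_top hα hgen x
    rw [Matrix.range_cons_cons_empty, Submodule.mem_span_pair]
    exact ⟨s, t, by simp [Algebra.smul_def]⟩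
  exact ⟨Basis.mk hli hsp, by simp, by simp⟩

open NumberField

theorem integer_coordinates {p : ℕ} (hp : p.Prime) (hp4 : p % 4 = 3) {s t : ℚ} {a n : ℤ}
    (ha : 2 * s = a) (hn : s ^ 2 + p * t ^ 2 = n) :
    ∃ u v : ℤ, s = u + v / 2 ∧ t = v / 2 := by
  have hpb : (p : ℚ) * (2 * t) ^ 2 = ((4 * n - a ^ 2 : ℤ) : ℚ) := by
    push_cast; rw [← ha, ← hn]; ring
  obtain ⟨v, hv⟩ : ∃ v : ℤ, 2 * t = v := by
    have hsq : Squarefree (p : ℤ) := (Nat.prime_iff_prime_int.mp hp).squarefree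
    generalize 2 * t = q at hpb
    have hd : (q.den : ℤ) * q.den ∣ p * (q.num * q.num) := by
      refine ⟨4 * n - a ^ 2, ?_⟩
      have : (p : ℚ) * (q.num * q.num) = q.den * q.den * ((4 * n - a ^ 2 : ℤ) : ℚ) := by
        rw [← hpb, ← Rat.mul_den_eq_num q]
        ring
      exact_mod_cast this
    have hcop : IsCoprime ((q.den : ℤ) * q.den) (q.num * q.num) := by
      have h : IsCoprime (q.den : ℤ) q.num := by
        rw [Int.isCoprime_iff_nat_coprime]
        simpa using q.reduced.symm
      exact (h.mul_left h).mul_right (h.mul_left h)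
    have hu := hsq _ (hcop.dvd_of_dvd_mul_right hd)
    have h1 : q.den = 1 := by simpa [Int.isUnit_iff_natAbs_eq] using hu
    exact ⟨q.num, ((Rat.den_eq_one_iff q).mp h1).symm⟩
  have hz : (p : ℤ) * v ^ 2 = 4 * n - a ^ 2 := by
    rw [hv] at hpb; exact_mod_cast hpb
  obtain ⟨k, hk⟩ : ∃ k : ℤ, (p : ℤ) = 4 * k + 3 := ⟨p / 4, by omega⟩
  have hpar : Even (a - v) := by
    have h2 : Even ((a - v) ^ 2) := by
      refine ⟨2 * n - a * v - (2 * k + 1) * v ^ 2, ?_⟩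
      rw [hk] at hz
      linear_combination hz
    simpa [Int.even_pow] using h2
  obtain ⟨u, hu⟩ := hpar
  have hu' : (a : ℚ) - v = u + u := by exact_mod_cast hu
  exact ⟨u, v, by linarith, by linarith⟩

/-- The ring of integers of `ℚ(√-p)` with `p ≡ 3 (mod 4)` prime has a basis `1, θ` with
`θ = (1 + √-p) / 2`. -/
theorem exists_integral_basis (hp : p.Prime) (hp4 : p % 4 = 3) (hα : α ^ 2 = -(p : K))
    (hgen : Algebra.adjoin ℚ ({α} : Set K) = ⊤) :
    ∃ b : Basis (Fin 2) ℤ (𝓞 K), b 0 = 1 ∧ b 1 * b 1 = (1 : ℤ) • b 1 - ((p + 1) / 4 : ℤ) • b 0 := by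
  obtain ⟨c, hc⟩ : ∃ c : ℤ, (p : ℤ) = 4 * c - 1 := ⟨(p + 1) / 4, by omega⟩
  have hcK : (p : K) = 4 * c - 1 := by exact_mod_cast congrArg (Int.cast : ℤ → K) hc
  have hθ : ((1 + α) / 2) ^ 2 = (1 + α) / 2 - (c : K) := by
    rw [hcK] at hα
    linear_combination hα / 4
  have hint : IsIntegral ℤ ((1 + α) / 2) := by
    refine ⟨.X ^ 2 - .X + .C c, by monicity!, ?_⟩
    simp [hθ, -eq_intCast]
  let θ : 𝓞 K := ⟨(1 + α) / 2, hint⟩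
  have hθα : (θ : K) = (1 + α) / 2 := rfl
  have hli : LinearIndependent ℤ ![(1 : 𝓞 K), θ] := by
    rw [LinearIndependent.pair_iff]
    intro s t h
    have h' := congrArg (algebraMap (𝓞 K) K) h
    simp only [zsmul_eq_mul, map_add, map_mul, map_intCast, map_zero, map_one, hθα] at h'
    have := eq_zero_of_add_mul_eq_zero (s := s + t / 2) (t := t / 2) hα hp.pos
      (by push_cast; rw [← h']; ring)
    have ht : t = 0 := by simpa using this.2
    exact ⟨by simpa [ht] using this.1, ht⟩
  have hsp : ⊤ ≤ Submodule.span ℤ (Set.range ![(1 : 𝓞 K), θ]) := by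
    intro x _
    obtain ⟨b, hb0, hb1⟩ := exists_basis_sqrt hα hp.pos hgen
    obtain ⟨s, t, hx⟩ := exists_eq_add_mul_of_adjoin_eq_top hα hgen x
    have hb : b 1 * b 1 = (0 : ℚ) • b 1 - (p : ℚ) • b 0 := by
      rw [hb0, hb1, ← sq, hα]; simp [Algebra.smul_def]
    have hx' : (x : K) = s • b 0 + t • b 1 := by
      rw [hx, hb0, hb1]; simp [Algebra.smul_def]
    have hxi : IsIntegral ℤ (x : K) := x.isIntegral_coe
    obtain ⟨a, ha⟩ := IsIntegrallyClosed.isIntegral_iff.mp (Algebra.isIntegral_trace (L := ℚ) hxi)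
    obtain ⟨n, hn⟩ := IsIntegrallyClosed.isIntegral_iff.mp (Algebra.isIntegral_norm ℚ hxi)
    rw [hx', trace_of_quadratic b hb0 hb] at ha
    rw [hx', norm_of_quadratic b hb0 hb] at hn
    obtain ⟨u, v, hu, hv⟩ := integer_coordinates hp hp4 (s := s) (t := t) (a := a) (n := n)
      (by simpa using ha.symm) (by simpa using hn.symm)
    rw [Matrix.range_cons_cons_empty, Submodule.mem_span_pair]
    refine ⟨u, v, ?_⟩
    apply RingOfIntegers.coe_injective
    trans (s + t * α : K)
    · rw [hu, hv]
      simp [hθα]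
      ring
    · exact hx.symm
  refine ⟨Basis.mk hli hsp, by simp, ?_⟩
  have hc' : ((p + 1) / 4 : ℤ) = c := by omega
  rw [hc']
  apply RingOfIntegers.coe_injective
  simp [hθα, ← sq, hθ]

end IntegralBasis

section Residue

open Module

open NumberField NumberField.InfinitePlace NumberField.Units

variable {K : Type*} [Field K] [NumberField K]

theorem isTotallyComplex_of_sq_eq_neg {α : K} {p : ℕ} (hα : α ^ 2 = -(p : K)) (hp : 0 < p) :
    IsTotallyComplex K where
  isComplex v := by
    rw [← not_isReal_iff_isComplex, isReal_iff]
    intro hv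
    have h := congrArg (ComplexEmbedding.IsReal.embedding hv) hα
    simp only [map_pow, map_neg, map_natCast] at h
    have hp' : (0 : ℝ) < p := by exact_mod_cast hp
    nlinarith [sq_nonneg (ComplexEmbedding.IsReal.embedding hv α)]

theorem nrComplexPlaces_eq_one_of_finrank_eq_two [IsTotallyComplex K] (h : finrank ℚ K = 2) :
    nrComplexPlaces K = 1 := by
  have := IsTotallyComplex.finrank K
  omega

theorem regulator_eq_one_of_rank_eq_zero (h : rank K = 0) : regulator K = 1 := by
  classical
  rw [regulator_eq_det']
  have e := equivFinRank K
  rw [h] at e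
  have := e.symm.isEmpty
  rw [Matrix.det_isEmpty, abs_one]

theorem rank_eq_zero_of_finrank_eq_two [IsTotallyComplex K] (h : finrank ℚ K = 2) :
    rank K = 0 := by
  have h1 := card_eq_nrRealPlaces_add_nrComplexPlaces K
  rw [IsTotallyComplex.nrRealPlaces_eq_zero, nrComplexPlaces_eq_one_of_finrank_eq_two h] at h1
  rw [Units.rank, h1]

variable {c : ℤ} (b : Basis (Fin 2) ℤ (𝓞 K)) (h0 : b 0 = 1)
  (h1 : b 1 * b 1 = (1 : ℤ) • b 1 - c • b 0)

include b in
theorem finrank_eq_two_of_basis : finrank ℚ K = 2 := by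
  rw [← RingOfIntegers.rank, finrank_eq_card_basis b, Fintype.card_fin]

include h0 h1

theorem discr_of_quadratic : discr K = 1 - 4 * c := by
  have h11 := trace_of_quadratic b h0 h1
  have t0 : Algebra.trace ℤ (𝓞 K) (b 0) = 2 := by simpa using h11 1 0
  have t1 : Algebra.trace ℤ (𝓞 K) (b 1) = 1 := by simpa using h11 0 1
  rw [← discr_eq_discr K b, Algebra.discr_def, Matrix.det_fin_two]
  simp only [Algebra.traceMatrix_apply, Algebra.traceForm_apply, h1, map_sub, map_smul, t0, t1]
  simp only [h0, one_mul, mul_one, t1]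
  rw [← h0, t0]
  simp only [smul_eq_mul]
  ring

omit [NumberField K] in
theorem units_eq_one_or_neg_one (hc : 1 < c) (x : (𝓞 K)ˣ) : x = 1 ∨ x = -1 := by
  obtain ⟨u, v, hx⟩ : ∃ u v : ℤ, (x : 𝓞 K) = u • b 0 + v • b 1 :=
    ⟨b.repr x 0, b.repr x 1, by rw [← Fin.sum_univ_two (fun i ↦ b.repr x i • b i), b.sum_repr]⟩
  have hn := norm_of_quadratic b h0 h1 u v
  rw [← hx] at hn
  have hN : Algebra.norm ℤ (x : 𝓞 K) = 1 ∨ Algebra.norm ℤ (x : 𝓞 K) = -1 :=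
    Int.isUnit_iff.mp (x.isUnit.map (Algebra.norm ℤ))
  have hv : v = 0 := by
    by_contra hv
    have : 0 < v ^ 2 := by positivity
    rcases hN with hN | hN <;> nlinarith [sq_nonneg (2 * u + v)]
  subst hv
  have hu : u = 1 ∨ u = -1 := by
    rw [← sq_eq_one_iff]
    rcases hN with hN | hN <;> nlinarith
  rcases hu with rfl | rfl
  · exact .inl (Units.ext (by simpa [h0] using hx))
  · exact .inr (Units.ext (by simpa [h0] using hx))

theorem torsionOrder_of_quadratic (hc : 1 < c) : torsionOrder K = 2 := by
  refine Nat.card_eq_two_iff.mpr ⟨1, ⟨-1, ?_⟩, ?_, ?_⟩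
  · exact isOfFinOrder_iff_pow_eq_one.mpr ⟨2, by norm_num, by simp⟩
  · intro h
    have h' := congrArg (fun x : torsion K ↦ ((x : (𝓞 K)ˣ) : 𝓞 K)) h
    simp only [OneMemClass.coe_one, Units.val_one, Units.val_neg] at h'
    exact (neg_ne_self.mpr one_ne_zero) h'.symm
  · rw [Set.eq_univ_iff_forall]
    rintro ⟨x, hx⟩
    rcases units_eq_one_or_neg_one b h0 h1 hc x with rfl | rfl
    · exact .inl rfl
    · exact .inr rfl

theorem dedekindZeta_residue_of_quadratic [IsTotallyComplex K] (hc : 1 < c) :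
    dedekindZeta_residue K = Real.pi * classNumber K / Real.sqrt (4 * c - 1) := by
  have h2 := finrank_eq_two_of_basis b
  have hd : |((1 - 4 * c : ℤ) : ℝ)| = 4 * c - 1 := by
    have : (1 : ℝ) < c := by exact_mod_cast hc
    push_cast
    rw [abs_of_neg (by linarith)]
    ring
  rw [dedekindZeta_residue_def, IsTotallyComplex.nrRealPlaces_eq_zero,
    nrComplexPlaces_eq_one_of_finrank_eq_two h2,
    regulator_eq_one_of_rank_eq_zero (rank_eq_zero_of_finrank_eq_two h2),
    torsionOrder_of_quadratic b h0 h1 hc, discr_of_quadratic b h0 h1, hd]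
  push_cast
  rw [pow_zero, pow_one, mul_one, one_mul, mul_assoc, mul_div_mul_left _ _ two_ne_zero]

end Residue

section IdealCount

open Ideal

variable {S : Type*} [CommRing S] [IsDedekindDomain S] [Module.Free ℤ S] [Module.Finite ℤ S]

theorem ncard_setOf_absNorm_eq_mul_and_dvd [CharZero S] {P : Ideal S} (hP : P ≠ ⊥) (n : ℕ) :
    {I : Ideal S | absNorm I = absNorm P * n ∧ P ∣ I}.ncard = {I : Ideal S | absNorm I = n}.ncard := by
  have hP' : absNorm P ≠ 0 := absNorm_eq_zero_iff.not.mpr hP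
  have : {I : Ideal S | absNorm I = absNorm P * n ∧ P ∣ I} =
      (fun J ↦ P * J) '' {I : Ideal S | absNorm I = n} := by
    ext I
    simp only [Set.mem_ofPred_eq, Set.mem_image]
    constructor
    · rintro ⟨h, J, rfl⟩
      rw [map_mul] at h
      exact ⟨J, mul_left_cancel₀ hP' h, rfl⟩
    · rintro ⟨J, rfl, rfl⟩
      exact ⟨map_mul _ _ _, dvd_mul_right _ _⟩
  rw [this, Set.ncard_image_of_injective _ fun I J h ↦ mul_left_cancel₀ hP h]

omit [Module.Finite ℤ S] in
theorem ncard_setOf_absNorm_eq_and_dvd_eq_zero {P : Ideal S} {m : ℕ} (h : ¬ absNorm P ∣ m) :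
    {I : Ideal S | absNorm I = m ∧ P ∣ I}.ncard = 0 := by
  convert! Set.ncard_empty (Ideal S)
  rw [Set.eq_empty_iff_forall_notMem]
  rintro _ ⟨rfl, J, rfl⟩
  exact h (by simp)

omit [Module.Finite ℤ S] in
theorem not_isCoprime_span_of_dvd_absNorm {q : ℕ} (hq : q.Prime) {I : Ideal S}
    (h0 : absNorm I ≠ 0) (h : q ∣ absNorm I) : ¬ IsCoprime I (span {(q : S)}) := by
  rw [isCoprime_iff_exists]
  rintro ⟨i, hi, y, hy, hiy⟩
  obtain ⟨y, rfl⟩ := mem_span_singleton'.mp hy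
  have : Finite (S ⧸ I) := Nat.finite_of_card_ne_zero h0
  have := Fact.mk hq
  obtain ⟨x, hx⟩ := exists_prime_addOrderOf_dvd_card' (G := S ⧸ I) q h
  obtain ⟨x, rfl⟩ := Ideal.Quotient.mk_surjective x
  have hqx := addOrderOf_nsmul_eq_zero (Ideal.Quotient.mk I x)
  have hx0 : Ideal.Quotient.mk I x ≠ 0 := by
    rintro h
    rw [h, addOrderOf_zero] at hx
    exact hq.one_lt.ne hx
  rw [hx, ← map_nsmul, Ideal.Quotient.eq_zero_iff_mem, nsmul_eq_mul] at hqx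
  refine hx0 (Ideal.Quotient.eq_zero_iff_mem.mpr ?_)
  have : x = x * i + y * (q * x) := by linear_combination -x * hiy
  rw [this]
  exact I.add_mem (I.mul_mem_left _ hi) (I.mul_mem_left _ hqx)

omit [Module.Free ℤ S] [Module.Finite ℤ S] in
theorem isCoprime_of_not_dvd {P I : Ideal S} (hP : P.IsMaximal) (h : ¬ P ∣ I) : IsCoprime I P :=
  isCoprime_iff_codisjoint.mpr
    (hP.out.not_le_iff_codisjoint.mp fun h' ↦ h (dvd_iff_le.mpr h')).symm

omit [Module.Finite ℤ S] in
theorem dvd_or_dvd_of_dvd_absNorm {q : ℕ} (hq : q.Prime) {P Q : Ideal S} (hP : P.IsMaximal)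
    (hQ : Q.IsMaximal) (hPQ : P * Q = span {(q : S)}) {I : Ideal S} (h0 : absNorm I ≠ 0)
    (h : q ∣ absNorm I) : P ∣ I ∨ Q ∣ I := by
  by_contra! hcon
  have hcop := (isCoprime_of_not_dvd hP hcon.1).mul_right (isCoprime_of_not_dvd hQ hcon.2)
  exact not_isCoprime_span_of_dvd_absNorm hq h0 h (hPQ ▸ hcop)

variable [CharZero S]

/-- The number of ideals of norm `q * n` for a prime `q` which splits. -/
theorem ncard_absNorm_eq_of_split {q : ℕ} (hq : q.Prime) {P Q : Ideal S} (hP : P.IsMaximal)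
    (hQ : Q.IsMaximal) (hPQ : P * Q = span {(q : S)}) (hne : P ≠ Q) (hNP : absNorm P = q)
    (hNQ : absNorm Q = q) {n : ℕ} (hn : n ≠ 0) :
    ({I : Ideal S | absNorm I = q * n}.ncard : ℤ) = (1 + 1) * {I : Ideal S | absNorm I = n}.ncard
      - 1 * if q ∣ n then {I : Ideal S | absNorm I = n / q}.ncard else 0 := by
  have hP0 : P ≠ ⊥ := by rintro rfl; simp [hq.ne_zero.symm] at hNP
  have hQ0 : Q ≠ ⊥ := by rintro rfl; simp [hq.ne_zero.symm] at hNQ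
  have hU : {I : Ideal S | absNorm I = q * n} =
      {I | absNorm I = q * n ∧ P ∣ I} ∪ {I | absNorm I = q * n ∧ Q ∣ I} := by
    ext I
    simp only [Set.mem_ofPred_eq, Set.mem_union, ← and_or_left, iff_self_and]
    exact fun h ↦ dvd_or_dvd_of_dvd_absNorm hq hP hQ hPQ
      (h ▸ mul_ne_zero hq.ne_zero hn) (h ▸ dvd_mul_right _ _)
  have hI : {I : Ideal S | absNorm I = q * n ∧ P ∣ I} ∩ {I | absNorm I = q * n ∧ Q ∣ I} =
      {I | absNorm I = q * n ∧ P * Q ∣ I} := by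
    ext I
    simp only [Set.mem_ofPred_eq, Set.mem_inter_iff, ← and_and_left]
    have hcop : IsCoprime P Q := isCoprime_iff_sup_eq.mpr (hP.coprime_of_ne hQ hne)
    exact and_congr_right fun _ ↦ ⟨fun h ↦ hcop.mul_dvd h.1 h.2,
      fun h ↦ ⟨dvd_of_mul_right_dvd h, dvd_of_mul_left_dvd h⟩⟩
  have hfin (R : Ideal S) : {I : Ideal S | absNorm I = q * n ∧ R ∣ I}.Finite :=
    (finite_setOfPred_absNorm_eq (q * n)).subset fun I h ↦ h.1
  have hcard := Set.ncard_union_add_ncard_inter _ _ (hfin P) (hfin Q)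
  have h1 := ncard_setOf_absNorm_eq_mul_and_dvd hP0 n
  have h2 := ncard_setOf_absNorm_eq_mul_and_dvd hQ0 n
  rw [hNP] at h1
  rw [hNQ] at h2
  rw [← hU, hI, h1, h2] at hcard
  have hNPQ : absNorm (P * Q) = q * q := by rw [map_mul, hNP, hNQ]
  split_ifs with hd
  · obtain ⟨k, rfl⟩ := hd
    have h3 := ncard_setOf_absNorm_eq_mul_and_dvd (mul_ne_zero hP0 hQ0) k
    rw [hNPQ, mul_assoc] at h3
    rw [h3] at hcard
    rw [Nat.mul_div_cancel_left _ hq.pos]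
    push_cast [← hcard]
    lia
  · rw [ncard_setOf_absNorm_eq_and_dvd_eq_zero
      (by rwa [hNPQ, Nat.mul_dvd_mul_iff_left hq.pos])] at hcard
    lia

/-- The number of ideals of norm `q * n` for a prime `q` which ramifies. -/
theorem ncard_absNorm_eq_of_ramified {q : ℕ} (hq : q.Prime) {P : Ideal S} (hP : P.IsMaximal)
    (hPP : P * P = span {(q : S)}) (hNP : absNorm P = q) {n : ℕ} (hn : n ≠ 0) :
    {I : Ideal S | absNorm I = q * n}.ncard = {I : Ideal S | absNorm I = n}.ncard := by
  have hP0 : P ≠ ⊥ := by rintro rfl; simp [hq.ne_zero.symm] at hNP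
  rw [← ncard_setOf_absNorm_eq_mul_and_dvd hP0 n, hNP]
  congr 1
  ext I
  simp only [Set.mem_ofPred_eq, iff_self_and]
  exact fun h ↦ or_self_iff.mp (dvd_or_dvd_of_dvd_absNorm hq hP hP hPP
    (h ▸ mul_ne_zero hq.ne_zero hn) (h ▸ dvd_mul_right _ _))

/-- The number of ideals of norm `q * n` for a prime `q` which is inert. -/
theorem ncard_absNorm_eq_of_inert {q : ℕ} (hq : q.Prime) (hP : (span {(q : S)}).IsMaximal)
    (hNP : absNorm (span {(q : S)}) = q * q) {n : ℕ} (hn : n ≠ 0) :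
    {I : Ideal S | absNorm I = q * n}.ncard =
      if q ∣ n then {I : Ideal S | absNorm I = n / q}.ncard else 0 := by
  have hP0 : span {(q : S)} ≠ ⊥ := by
    intro h
    rw [h, absNorm_bot] at hNP
    exact (mul_ne_zero hq.ne_zero hq.ne_zero) hNP.symm
  have hU : {I : Ideal S | absNorm I = q * n} =
      {I | absNorm I = q * n ∧ span {(q : S)} ∣ I} := by
    ext I
    simp only [Set.mem_ofPred_eq, iff_self_and]
    intro h
    by_contra hcon
    exact not_isCoprime_span_of_dvd_absNorm hq (h ▸ mul_ne_zero hq.ne_zero hn)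
      (h ▸ dvd_mul_right _ _) (isCoprime_of_not_dvd hP hcon)
  rw [hU]
  split_ifs with hd
  · obtain ⟨k, rfl⟩ := hd
    rw [← mul_assoc, ← hNP, ncard_setOf_absNorm_eq_mul_and_dvd hP0,
      Nat.mul_div_cancel_left _ hq.pos]
  · exact ncard_setOf_absNorm_eq_and_dvd_eq_zero (by rwa [hNP, Nat.mul_dvd_mul_iff_left hq.pos])

end IdealCount

section Splitting

open Ideal Module

variable {S : Type*} [CommRing S] [IsDedekindDomain S] [Module.Free ℤ S] [Module.Finite ℤ S]
  [CharZero S] {b : Basis (Fin 2) ℤ S} {c : ℤ}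

omit [IsDedekindDomain S] [Module.Free ℤ S] [Module.Finite ℤ S] in
theorem span_ne_top_of_quadratic (h0 : b 0 = 1) (h1 : b 1 * b 1 = (1 : ℤ) • b 1 - c • b 0) {q : ℕ}
    (hq : q.Prime) {r : ℤ} (hr : (q : ℤ) ∣ r ^ 2 - r + c) : span {(q : S), b 1 - r} ≠ ⊤ := by
  rw [Ne, eq_top_iff_one, mem_span_pair]
  rintro ⟨x, y, hxy⟩
  obtain ⟨k, hk⟩ := hr
  have hk' : (r : S) ^ 2 - r + c = q * k := by exact_mod_cast congrArg (Int.cast : ℤ → S) hk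
  simp only [one_smul, h0, zsmul_eq_mul, mul_one] at h1
  have h2 : b 1 = q * (x * (b 1 - 1 + r) - y * k) + (1 - r) := by
    linear_combination -(b 1 - 1 + r) * hxy + y * h1 - y * hk'
  have h3 : b 1 = (q : ℤ) • (x * (b 1 - 1 + r) - y * k) + (1 - r) • b 0 := by
    rw [h0]
    simpa using h2
  have h4 := congrArg (fun x ↦ b.repr x 1) h3
  simp only [map_add, map_smul, Finsupp.add_apply, Finsupp.smul_apply, smul_eq_mul,
    Basis.repr_self] at h4
  simp at h4
  exact hq.one_lt.ne' (by exact_mod_cast Int.eq_one_of_mul_eq_one_right (by positivity) h4.symm)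

omit [CharZero S] in
theorem isMaximal_of_absNorm_eq_prime {q : ℕ} (hq : q.Prime) {P : Ideal S} (h : absNorm P = q) :
    P.IsMaximal := by
  have hP : P.IsPrime := isPrime_of_irreducible_absNorm (h ▸ hq)
  refine hP.isMaximal ?_
  rintro rfl
  simp [hq.ne_zero.symm] at h

theorem ncard_absNorm_eq_of_dvd (h0 : b 0 = 1) (h1 : b 1 * b 1 = (1 : ℤ) • b 1 - c • b 0) {q : ℕ}
    (hq : q.Prime) {r : ℤ} (hr : (q : ℤ) ∣ r ^ 2 - r + c) (hr' : ¬ (q : ℤ) ∣ 2 * r - 1)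
    {n : ℕ} (hn : n ≠ 0) :
    ({I : Ideal S | absNorm I = q * n}.ncard : ℤ) = (1 + 1) * {I : Ideal S | absNorm I = n}.ncard
      - 1 * if q ∣ n then {I : Ideal S | absNorm I = n / q}.ncard else 0 := by
  have hP := span_ne_top_of_quadratic h0 h1 hq hr
  have hQ := span_ne_top_of_quadratic h0 h1 hq (r := 1 - r) (by convert hr using 1; ring)
  obtain ⟨x, y, hxy⟩ : IsCoprime (q : ℤ) (2 * r - 1) :=
    ((Nat.prime_iff_prime_int.mp hq).coprime_iff_not_dvd).mpr hr'
  have hxy' : (x * q + y * (2 * r - 1) : S) = 1 := by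
    exact_mod_cast congrArg (Int.cast : ℤ → S) hxy
  obtain ⟨k, hk⟩ := hr
  have hk' : (r : S) ^ 2 - r + c = q * k := by exact_mod_cast congrArg (Int.cast : ℤ → S) hk
  have h1' := h1
  simp only [one_smul, h0, zsmul_eq_mul, mul_one] at h1'
  set P := span {(q : S), b 1 - r} with hPdef
  set Q := span {(q : S), b 1 - (1 - r : ℤ)} with hQdef
  have hPQ : P * Q = span {(q : S)} := by
    rw [hPdef, hQdef, span_pair_mul_span_pair]
    refine le_antisymm ?_ ?_
    · rw [span_le]
      rintro z (rfl | rfl | rfl | rfl)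
      · exact mem_span_singleton.mpr (dvd_mul_right _ _)
      · exact mem_span_singleton.mpr (dvd_mul_right _ _)
      · exact mem_span_singleton.mpr (dvd_mul_left _ _)
      · refine mem_span_singleton.mpr ⟨-k, ?_⟩
        push_cast
        linear_combination h1' - hk'
    · rw [span_singleton_le_iff_mem]
      have : x * (q * q) + y * (q * (b 1 - (1 - r : ℤ)) - (b 1 - r) * q) = (q : S) := by
        push_cast
        linear_combination (q : S) * hxy'
      refine (congrArg (· ∈ _) this).mp <| add_mem (mul_mem_left _ _ (subset_span (.inl rfl)))
        (mul_mem_left _ _ (sub_mem (subset_span (.inr (.inl rfl)))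
          (subset_span (.inr (.inr (.inl rfl))))))
  have hN : absNorm P * absNorm Q = q ^ 2 := by
    rw [← map_mul, hPQ, absNorm_span_natCast, finrank_eq_card_basis b, Fintype.card_fin]
  obtain ⟨hNP, hNQ⟩ := (hq.mul_eq_prime_sq_iff (mt absNorm_eq_one_iff.mp hP)
    (mt absNorm_eq_one_iff.mp hQ)).mp hN
  refine ncard_absNorm_eq_of_split hq (isMaximal_of_absNorm_eq_prime hq hNP)
    (isMaximal_of_absNorm_eq_prime hq hNQ) hPQ ?_ hNP hNQ hn
  intro hEq
  refine hP ((eq_top_iff_one _).mpr ?_)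
  have hq' : (q : S) ∈ P := subset_span (by simp)
  have hr1 : b 1 - r ∈ P := subset_span (by simp)
  have hr2 : b 1 - (1 - r : ℤ) ∈ P := by
    rw [hEq]
    exact subset_span (by simp)
  have : (1 : S) = x * q + y * ((b 1 - (1 - r : ℤ)) - (b 1 - r)) := by
    push_cast
    linear_combination -hxy'
  rw [this]
  exact add_mem (mul_mem_left _ _ hq') (mul_mem_left _ _ (sub_mem hr2 hr1))

theorem ncard_absNorm_eq_of_discr (h0 : b 0 = 1) (h1 : b 1 * b 1 = (1 : ℤ) • b 1 - c • b 0)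
    {p : ℕ} (hp : p.Prime) (hpc : (p : ℤ) = 4 * c - 1) {n : ℕ} (hn : n ≠ 0) :
    {I : Ideal S | absNorm I = p * n}.ncard = {I : Ideal S | absNorm I = n}.ncard := by
  simp only [one_smul, h0, zsmul_eq_mul, mul_one] at h1
  have hpc' : (p : S) = 4 * c - 1 := by exact_mod_cast congrArg (Int.cast : ℤ → S) hpc
  have hPP : span {2 * b 1 - 1} * span {2 * b 1 - 1} = span {(p : S)} := by
    rw [span_singleton_mul_span_singleton, ← span_singleton_neg]
    congr 2
    linear_combination -4 * h1 - hpc'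
  have hN : absNorm (span {2 * b 1 - 1}) = p := by
    have h := congrArg absNorm hPP
    rw [map_mul, absNorm_span_natCast, finrank_eq_card_basis b, Fintype.card_fin, ← sq] at h
    exact pow_left_injective two_ne_zero h
  exact ncard_absNorm_eq_of_ramified hp (isMaximal_of_absNorm_eq_prime hp hN) hPP hN hn

theorem ncard_absNorm_eq_of_not_dvd (h0 : b 0 = 1)
    (h1 : b 1 * b 1 = (1 : ℤ) • b 1 - c • b 0) {q : ℕ}
    (hq : q.Prime) (hr : ∀ r : ℤ, ¬ (q : ℤ) ∣ r ^ 2 - r + c) {n : ℕ} (hn : n ≠ 0) :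
    {I : Ideal S | absNorm I = q * n}.ncard =
      if q ∣ n then {I : Ideal S | absNorm I = n / q}.ncard else 0 := by
  simp only [one_smul, h0, zsmul_eq_mul, mul_one] at h1
  have hN : absNorm (span {(q : S)}) = q ^ 2 := by
    rw [absNorm_span_natCast, finrank_eq_card_basis b, Fintype.card_fin]
  refine ncard_absNorm_eq_of_inert hq ?_ (by rw [hN, sq]) hn
  have htop : span {(q : S)} ≠ ⊤ := by
    intro h
    rw [h, absNorm_top] at hN
    exact (one_lt_pow₀ hq.one_lt two_ne_zero).ne hN
  obtain ⟨R, hR, hle⟩ := exists_le_maximal _ htop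
  obtain ⟨J, hJ⟩ := dvd_iff_le.mpr hle
  rw [hJ, map_mul] at hN
  obtain ⟨i, hi, hRi⟩ := (Nat.dvd_prime_pow hq).mp (Dvd.intro _ hN)
  interval_cases i
  · exact absurd (absNorm_eq_one_iff.mp (by simpa using hRi)) hR.ne_top
  · exfalso
    rw [pow_one] at hRi
    have hcard : Nat.card (S ⧸ R) = q := hRi
    have : Finite (S ⧸ R) := Nat.finite_of_card_ne_zero (hcard ▸ hq.ne_zero)
    have := Fintype.ofFinite (S ⧸ R)
    let e := ZMod.ringEquivOfPrime (S ⧸ R) hq (by rw [← Nat.card_eq_fintype_card, hcard])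
    obtain ⟨r, hre⟩ := ZMod.intCast_surjective (e.symm (Ideal.Quotient.mk R (b 1)))
    refine hr r ((ZMod.intCast_zmod_eq_zero_iff_dvd _ q).mp ?_)
    have := congrArg (fun x ↦ e.symm (Ideal.Quotient.mk R x)) h1
    simp only [map_mul, map_sub, map_intCast, ← hre] at this
    push_cast
    linear_combination this
  · have : absNorm J = 1 := by
      rw [hRi] at hN
      exact Nat.eq_of_mul_eq_mul_left (pow_pos hq.pos 2) (by simpa using hN)
    rw [absNorm_eq_one_iff.mp this, mul_top] at hJ
    rwa [hJ]

end Splitting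

section PrimeNorm

open Ideal Module

theorem dvd_two_mul_sub_one_sq {c : ℤ} {p q : ℕ} (hpc : (p : ℤ) = 4 * c - 1) {r : ℤ}
    (hr : (q : ℤ) ∣ r ^ 2 - r + c) : (q : ℤ) ∣ (2 * r - 1) ^ 2 + p := by
  have : (2 * r - 1) ^ 2 + p = 4 * (r ^ 2 - r + c) := by linear_combination hpc
  exact this ▸ hr.mul_left 4

theorem legendreSym_eq_legendreSym_neg {p q : ℕ} [Fact p.Prime] [Fact q.Prime] (hp4 : p % 4 = 3)
    (hq : q ≠ 2) : legendreSym p q = legendreSym q (-p) := by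
  have : (-p : ℤ) = -1 * p := by ring
  rw [this, legendreSym.mul, legendreSym.at_neg_one hq]
  rcases Nat.odd_mod_four_iff.mp ((Fact.out : q.Prime).eq_two_or_odd.resolve_left hq) with h | h
  · rw [ZMod.χ₄_nat_one_mod_four h, one_mul,
      legendreSym.quadratic_reciprocity_one_mod_four h (by lia)]
  · rw [ZMod.χ₄_nat_three_mod_four h,
      legendreSym.quadratic_reciprocity_three_mod_four h hp4]
    ring

theorem legendreSym_eq_one_iff_exists_dvd {c : ℤ} {p : ℕ} [Fact p.Prime]
    (hpc : (p : ℤ) = 4 * c - 1) {q : ℕ} (hq : q.Prime) (hqp : q ≠ p) :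
    legendreSym p q = 1 ↔ ∃ r : ℤ, (q : ℤ) ∣ r ^ 2 - r + c := by
  have := Fact.mk hq
  have hp4 : p % 4 = 3 := by lia
  by_cases hq2 : q = 2
  · subst hq2
    have h2 : ((2 : ℤ) : ZMod p) ≠ 0 := by
      rw [Ne, ZMod.intCast_zmod_eq_zero_iff_dvd]
      intro h
      have := Int.le_of_dvd two_pos h
      lia
    rw [Nat.cast_two, legendreSym.eq_one_iff p h2]
    push_cast
    rw [ZMod.exists_sq_eq_two_iff (by lia)]
    constructor
    · exact fun h ↦ ⟨0, by lia⟩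
    · rintro ⟨r, hr⟩
      have : (2 : ℤ) ∣ r ^ 2 - r := by
        have := (Int.even_mul_pred_self r).two_dvd
        rwa [mul_sub, mul_one, ← sq] at this
      have : (2 : ℤ) ∣ c := (dvd_add_right this).mp hr
      lia
  · have hp0 : ((-p : ℤ) : ZMod q) ≠ 0 := by
      rw [Ne, ZMod.intCast_zmod_eq_zero_iff_dvd, dvd_neg, Int.natCast_dvd_natCast]
      exact fun h ↦ hqp ((Nat.prime_dvd_prime_iff_eq hq Fact.out).mp h)
    rw [legendreSym_eq_legendreSym_neg hp4 hq2, legendreSym.eq_one_iff q hp0]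
    constructor
    · rintro ⟨s, hs⟩
      have h2 : (2 : ZMod q) ≠ 0 := by
        have : ((2 : ℕ) : ZMod q) ≠ 0 := by
          rw [Ne, ZMod.natCast_eq_zero_iff]
          exact fun h ↦ hq2 ((Nat.prime_dvd_prime_iff_eq hq Nat.prime_two).mp h)
        exact_mod_cast this
      obtain ⟨r, hr⟩ := ZMod.intCast_surjective ((s + 1) / 2)
      have hr2 : 2 * (r : ZMod q) = s + 1 := by rw [hr]; field_simp
      have hpc' : (p : ZMod q) = 4 * c - 1 := by
        exact_mod_cast congrArg (Int.cast : ℤ → ZMod q) hpc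
      refine ⟨r, (ZMod.intCast_zmod_eq_zero_iff_dvd _ q).mp ?_⟩
      push_cast at hs ⊢
      have : 2 * (2 * ((r : ZMod q) ^ 2 - r + c)) = 0 := by
        linear_combination (2 * (r : ZMod q) + s - 1) * hr2 - hs - hpc'
      simpa [h2] using this
    · rintro ⟨r, hr⟩
      have := (ZMod.intCast_zmod_eq_zero_iff_dvd _ q).mpr (dvd_two_mul_sub_one_sq hpc hr)
      refine ⟨2 * r - 1, ?_⟩
      push_cast at this ⊢
      linear_combination -this

variable {S : Type*} [CommRing S] [IsDedekindDomain S] [Module.Free ℤ S] [Module.Finite ℤ S]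
  [CharZero S] {b : Basis (Fin 2) ℤ S} {c : ℤ}

theorem ncard_absNorm_eq_legendreSym (h0 : b 0 = 1) (h1 : b 1 * b 1 = (1 : ℤ) • b 1 - c • b 0)
    {p : ℕ} [Fact p.Prime] (hpc : (p : ℤ) = 4 * c - 1) {q : ℕ} (hq : q.Prime) {n : ℕ}
    (hn : n ≠ 0) :
    ({I : Ideal S | absNorm I = q * n}.ncard : ℤ) =
      (1 + legendreSym p q) * {I : Ideal S | absNorm I = n}.ncard
      - legendreSym p q * if q ∣ n then {I : Ideal S | absNorm I = n / q}.ncard else 0 := by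
  have hp : p.Prime := Fact.out
  by_cases hqp : q = p
  · subst hqp
    have : legendreSym q q = 0 := by simp [legendreSym.eq_zero_iff]
    rw [this, ncard_absNorm_eq_of_discr h0 h1 hp hpc hn]
    ring
  have hiff := legendreSym_eq_one_iff_exists_dvd hpc hq hqp
  by_cases hr : ∃ r : ℤ, (q : ℤ) ∣ r ^ 2 - r + c
  · rw [hiff.mpr hr]
    obtain ⟨r, hr⟩ := hr
    refine ncard_absNorm_eq_of_dvd h0 h1 hq hr (fun h ↦ hqp ?_) hn
    have := (dvd_add_right (dvd_pow h two_ne_zero)).mp (dvd_two_mul_sub_one_sq hpc hr)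
    exact (Nat.prime_dvd_prime_iff_eq hq hp).mp (Int.natCast_dvd_natCast.mp this)
  · have hq0 : ((q : ℤ) : ZMod p) ≠ 0 := by
      rw [Ne, ZMod.intCast_zmod_eq_zero_iff_dvd, Int.natCast_dvd_natCast]
      exact fun h ↦ hqp ((Nat.prime_dvd_prime_iff_eq hp hq).mp h).symm
    rw [(legendreSym.eq_one_or_neg_one p hq0).resolve_left fun h ↦ hr (hiff.mp h)]
    push Not at hr
    rw [ncard_absNorm_eq_of_not_dvd h0 h1 hq hr hn]
    push_cast
    ring

end PrimeNorm

section NormCount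

open Ideal Module

theorem sum_divisors_filter_dvd {R : Type*} [CommRing R] {f : ℕ → R}
    (hf : ∀ a b, f (a * b) = f a * f b) {q n : ℕ} (hq : q ≠ 0) (hn : n ≠ 0) :
    ∑ d ∈ (q * n).divisors with q ∣ d, f d = f q * ∑ d ∈ n.divisors, f d := by
  have : (q * n).divisors.filter (q ∣ ·) = n.divisors.image (q * ·) := by
    ext d
    simp only [Finset.mem_filter, Nat.mem_divisors, Finset.mem_image]
    constructor
    · rintro ⟨⟨h, -⟩, e, rfl⟩
      exact ⟨e, ⟨Nat.dvd_of_mul_dvd_mul_left (Nat.pos_of_ne_zero hq) h, hn⟩, rfl⟩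
    · rintro ⟨e, ⟨h, -⟩, rfl⟩
      exact ⟨⟨mul_dvd_mul_left q h, mul_ne_zero hq hn⟩, dvd_mul_right q e⟩
  rw [this, Finset.sum_image fun a _ b _ h ↦ Nat.eq_of_mul_eq_mul_left (Nat.pos_of_ne_zero hq) h,
    Finset.mul_sum]
  simp [hf]

theorem sum_divisors_prime_mul {R : Type*} [CommRing R] {f : ℕ → R}
    (hf : ∀ a b, f (a * b) = f a * f b) {q n : ℕ} (hq : q.Prime) (hn : n ≠ 0) :
    ∑ d ∈ (q * n).divisors, f d = (1 + f q) * ∑ d ∈ n.divisors, f d -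
      f q * if q ∣ n then ∑ d ∈ (n / q).divisors, f d else 0 := by
  have h1 : f q * (if q ∣ n then ∑ d ∈ (n / q).divisors, f d else 0) =
      ∑ d ∈ n.divisors with q ∣ d, f d := by
    split_ifs with h
    · obtain ⟨k, rfl⟩ := h
      rw [Nat.mul_div_cancel_left _ hq.pos,
        sum_divisors_filter_dvd hf hq.ne_zero (right_ne_zero_of_mul hn)]
    · rw [Finset.filter_false_of_mem fun d hd hqd ↦ h (hqd.trans (Nat.dvd_of_mem_divisors hd))]
      simp
  have h2 : (q * n).divisors.filter (¬ q ∣ ·) = n.divisors.filter (¬ q ∣ ·) := by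
    ext d
    simp only [Finset.mem_filter, Nat.mem_divisors, and_congr_left_iff]
    intro hd
    have : Nat.Coprime d q := ((Nat.Prime.coprime_iff_not_dvd hq).mpr hd).symm
    simp [hn, hq.ne_zero, this.dvd_mul_left]
  rw [h1, ← Finset.sum_filter_add_sum_filter_not (q * n).divisors (q ∣ ·), h2,
    sum_divisors_filter_dvd hf hq.ne_zero hn,
    ← Finset.sum_filter_add_sum_filter_not n.divisors (q ∣ ·) f]
  ring

variable {S : Type*} [CommRing S] [IsDedekindDomain S] [Module.Free ℤ S] [Module.Finite ℤ S]
  [CharZero S] {b : Basis (Fin 2) ℤ S} {c : ℤ}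

theorem ncard_absNorm_eq_sum_divisors (h0 : b 0 = 1)
    (h1 : b 1 * b 1 = (1 : ℤ) • b 1 - c • b 0) {p : ℕ} [Fact p.Prime] (hpc : (p : ℤ) = 4 * c - 1)
    {n : ℕ} (hn : n ≠ 0) :
    ({I : Ideal S | absNorm I = n}.ncard : ℤ) = ∑ d ∈ n.divisors, legendreSym p d := by
  induction n using Nat.strong_induction_on with
  | _ n ih =>
    by_cases h : n = 1
    · simp [h, absNorm_eq_one_iff, legendreSym.at_one]
    · obtain ⟨q, hq, m, rfl⟩ := Nat.exists_prime_and_dvd h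
      have hm : m ≠ 0 := right_ne_zero_of_mul hn
      have hlt : m < q * m := by nlinarith [hq.two_le, Nat.pos_of_ne_zero hm]
      have hmul (a b : ℕ) : legendreSym p ((a * b : ℕ) : ℤ) = legendreSym p a * legendreSym p b := by
        rw [Nat.cast_mul, legendreSym.mul]
      rw [ncard_absNorm_eq_legendreSym h0 h1 hpc hq hm, ih m hlt hm,
        sum_divisors_prime_mul (f := fun d : ℕ ↦ legendreSym p d) hmul hq hm]
      congr 2
      split_ifs with hd
      · exact ih _ ((Nat.div_le_self m q).trans_lt hlt) (Nat.div_pos (Nat.le_of_dvd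
          (Nat.pos_of_ne_zero hm) hd) hq.pos).ne'
      · rfl

end NormCount

section ZetaFactorization

open Ideal Module Filter Topology

section LFunction

open DirichletCharacter in
theorem LSeries_zetaMul {N : ℕ} [NeZero N] (χ : DirichletCharacter ℂ N) {s : ℂ} (hs : 1 < s.re) :
    LSeries χ.zetaMul s = riemannZeta s * LFunction χ s := by
  rw [zetaMul, ← ArithmeticFunction.coe_mul, LSeries_convolution', LFunction_eq_LSeries χ hs]
  · congr 1
    · simp_rw [← ArithmeticFunction.LSeries_zeta_eq_riemannZeta hs,
        ← ArithmeticFunction.natCoe_apply]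
    · exact (LSeries_congr χ.apply_eq_toArithmeticFunction_apply s).symm
  · exact ArithmeticFunction.LSeriesSummable_zeta_iff.mpr hs
  · exact (LSeriesSummable_congr _ fun h ↦ (χ.apply_eq_toArithmeticFunction_apply h).symm).mpr <|
      ZMod.LSeriesSummable_of_one_lt_re χ hs

/-- The quadratic Dirichlet character modulo a prime. -/
noncomputable def legendreChar (p : ℕ) [Fact p.Prime] : DirichletCharacter ℂ p :=
  (quadraticChar (ZMod p)).ringHomComp (Int.castRingHom ℂ)

theorem legendreChar_natCast (p : ℕ) [Fact p.Prime] (n : ℕ) :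
    legendreChar p n = legendreSym p n := by
  simp [legendreChar, legendreSym]

theorem odd_legendreChar {p : ℕ} [Fact p.Prime] (hp4 : p % 4 = 3) : (legendreChar p).Odd := by
  have h := legendreSym.at_neg_one (p := p) (by lia)
  rw [ZMod.χ₄_nat_three_mod_four hp4, legendreSym] at h
  simp only [DirichletCharacter.Odd, legendreChar, MulChar.ringHomComp_apply]
  push_cast at h
  rw [h]
  simp

theorem legendreChar_ne_one {p : ℕ} [Fact p.Prime] (hp4 : p % 4 = 3) : legendreChar p ≠ 1 := by
  intro h
  have := odd_legendreChar hp4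
  rw [DirichletCharacter.Odd, h, MulChar.one_apply isUnit_one.neg] at this
  norm_num at this

end LFunction

section ClassNumberFormula

open NumberField

variable {K : Type*} [Field K] [NumberField K] {b : Basis (Fin 2) ℤ (𝓞 K)} {c : ℤ}

theorem dedekindZeta_eq_mul (h0 : b 0 = 1) (h1 : b 1 * b 1 = (1 : ℤ) • b 1 - c • b 0) {p : ℕ}
    [Fact p.Prime] (hpc : (p : ℤ) = 4 * c - 1) {s : ℂ} (hs : 1 < s.re) :
    dedekindZeta K s = riemannZeta s * (legendreChar p).LFunction s := by
  rw [← LSeries_zetaMul _ hs, dedekindZeta]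
  refine LSeries_congr (fun {n} hn ↦ ?_) s
  have h := congrArg (Int.cast : ℤ → ℂ) (ncard_absNorm_eq_sum_divisors h0 h1 hpc hn)
  push_cast at h
  rw [DirichletCharacter.zetaMul, ArithmeticFunction.coe_zeta_mul_apply]
  refine (Eq.trans ?_ h).trans (Finset.sum_congr rfl fun d hd ↦ ?_)
  · rfl
  · rw [← DirichletCharacter.apply_eq_toArithmeticFunction_apply _
      (Nat.pos_of_mem_divisors hd).ne', legendreChar_natCast]

theorem LFunction_legendreChar_one (h0 : b 0 = 1) (h1 : b 1 * b 1 = (1 : ℤ) • b 1 - c • b 0)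
    {p : ℕ} [Fact p.Prime] (hpc : (p : ℤ) = 4 * c - 1) [IsTotallyComplex K] (hc : 1 < c) :
    (legendreChar p).LFunction 1 = Real.pi * classNumber K / Real.sqrt p := by
  have hcont := (DirichletCharacter.differentiable_LFunction (legendreChar_ne_one (p := p)
    (by lia))).continuous.tendsto 1
  have hofReal : Tendsto (fun s : ℝ ↦ (s : ℂ)) (𝓝[>] 1) (𝓝[≠] 1) := by
    refine tendsto_nhdsWithin_iff.mpr ⟨?_, ?_⟩
    · exact (Complex.continuous_ofReal.tendsto 1).mono_left nhdsWithin_le_nhds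
    · filter_upwards [self_mem_nhdsWithin] with s hs
      exact Complex.ofReal_ne_one.mpr (Set.mem_Ioi.mp hs).ne'
  have hlim := (riemannZeta_residue_one.comp hofReal).mul
    (hcont.comp (hofReal.mono_right nhdsWithin_le_nhds))
  rw [one_mul] at hlim
  have hlim' := tendsto_sub_one_mul_dedekindZeta_nhdsGT K
  have := tendsto_nhds_unique (hlim.congr' ?_) hlim'
  · rw [this, dedekindZeta_residue_of_quadratic b h0 h1 hc]
    have : (4 * c - 1 : ℝ) = p := by exact_mod_cast hpc.symm
    rw [this]
    push_cast
    rfl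
  · filter_upwards [self_mem_nhdsWithin] with s hs
    have hs' : 1 < (s : ℂ).re := hs
    simp only [Function.comp_apply]
    rw [dedekindZeta_eq_mul h0 h1 hpc hs']
    ring

end ClassNumberFormula

end ZetaFactorization

section Cotangent

open Filter Topology

theorem abs_one_div_rpow_sub_le {m a b s : ℝ} (hm : 0 < m) (ha : a ∈ Set.Icc m 1)
    (hb : b ∈ Set.Icc m 1) (hs : s ∈ Set.Icc 1 2) (n : ℕ) :
    |1 / (n + a) ^ s - 1 / (n + b) ^ s| ≤ 2 / m ^ 2 * (1 / (n + 1 : ℝ) ^ 2) := by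
  have hn : (0 : ℝ) ≤ n := n.cast_nonneg
  have hs0 : 0 ≤ s := zero_le_one.trans hs.1
  have hm1 : m ≤ 1 := ha.1.trans ha.2
  have hmem {x : ℝ} (hx : x ∈ Set.Icc m 1) :
      1 / (n + x) ^ s ∈ Set.Icc (1 / (n + 1 : ℝ) ^ s) (1 / (n + m) ^ s) := by
    have hx0 : 0 < x := hm.trans_le hx.1
    constructor
    · exact one_div_le_one_div_of_le (by positivity)
        (Real.rpow_le_rpow (by positivity) (by linarith [hx.2]) hs0)
    · exact one_div_le_one_div_of_le (by positivity)
        (Real.rpow_le_rpow (by positivity) (by linarith [hx.1]) hs0)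
  refine (Set.abs_sub_le_of_uIcc_subset_uIcc ?_).trans (b := |1 / (n + m) ^ s - 1 / (n + 1 : ℝ) ^ s|) ?_
  · rw [Set.uIcc_of_le ((hmem ha).1.trans (hmem ha).2)]
    exact Set.uIcc_subset_Icc (hmem hb) (hmem ha)
  · rw [abs_of_nonneg (sub_nonneg.mpr ((hmem ha).1.trans (hmem ha).2))]
    set r : ℝ := (n + m) / (n + 1) with hr
    have hr0 : 0 < r := by positivity
    have hr1 : r ≤ 1 := by rw [hr, div_le_one (by positivity)]; linarith
    have hrm : m ≤ r := by
      rw [hr, le_div_iff₀ (by positivity)]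
      nlinarith
    have h1r : 1 - r ≤ 1 / (n + 1) := by
      rw [hr, one_sub_div (by positivity)]
      gcongr
      linarith
    have hnm : (n + m : ℝ) = (n + 1) * r := by rw [hr]; field_simp
    have hrs : r ^ 2 ≤ r ^ s := by
      have := Real.rpow_le_rpow_of_exponent_ge hr0 hr1 hs.2
      simpa using this
    have hms : m ^ 2 ≤ r ^ s := (pow_le_pow_left₀ hm.le hrm 2).trans hrs
    have hns : (n + 1 : ℝ) ≤ (n + 1) ^ s := by
      simpa using Real.rpow_le_rpow_of_exponent_le (x := (n + 1 : ℝ)) (by linarith) hs.1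
    rw [hnm, Real.mul_rpow (by positivity) hr0.le]
    have h1 : 1 / ((n + 1 : ℝ) ^ s * r ^ s) - 1 / (n + 1 : ℝ) ^ s =
        (1 - r ^ s) * (1 / r ^ s) * (1 / (n + 1 : ℝ) ^ s) := by
      field_simp
    rw [h1]
    have h2 : 1 - r ^ s ≤ 2 * (1 / (n + 1)) := by nlinarith
    calc (1 - r ^ s) * (1 / r ^ s) * (1 / (n + 1 : ℝ) ^ s)
        ≤ (2 * (1 / (n + 1))) * (1 / m ^ 2) * (1 / (n + 1 : ℝ)) := by gcongr
      _ = _ := by field_simp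

theorem hurwitzZetaOdd_one {a : ℝ} (ha : a ∈ Set.Ioo 0 1) :
    HurwitzZeta.hurwitzZetaOdd a 1 = Real.pi / 2 * Complex.cot (Real.pi * a) := by
  set m := min a (1 - a) with hm
  have hm0 : 0 < m := lt_min ha.1 (sub_pos.mpr ha.2)
  have haI : a ∈ Set.Icc m 1 := ⟨min_le_left _ _, ha.2.le⟩
  have haI' : 1 - a ∈ Set.Icc m 1 := ⟨min_le_right _ _, by linarith [ha.1]⟩
  let f (s : ℝ) (n : ℕ) : ℝ := (1 / (n + a) ^ s - 1 / (n + (1 - a)) ^ s) / 2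
  have hbound : Summable fun n : ℕ ↦ 2 / m ^ 2 * (1 / (n + 1 : ℝ) ^ 2) := by
    refine Summable.mul_left _ ?_
    exact_mod_cast (summable_nat_add_iff 1).mpr (Real.summable_one_div_nat_pow.mpr one_lt_two)
  have hle {s : ℝ} (hs : s ∈ Set.Icc 1 2) (n : ℕ) : ‖f s n‖ ≤ 2 / m ^ 2 * (1 / (n + 1 : ℝ) ^ 2) := by
    have := abs_one_div_rpow_sub_le hm0 haI haI' hs n
    rw [Real.norm_eq_abs, abs_div, abs_two]
    linarith [abs_nonneg (1 / (n + a) ^ s - 1 / (n + (1 - a)) ^ s)]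
  have hlim : Tendsto (fun s ↦ ∑' n, f s n) (𝓝[>] 1) (𝓝 (∑' n, f 1 n)) := by
    refine tendsto_tsum_of_dominated_convergence hbound (fun n ↦ ?_) ?_
    · have h1 : (n + a : ℝ) ≠ 0 := by have := ha.1; positivity
      have h2 : (n + (1 - a) : ℝ) ≠ 0 := by have := sub_pos.mpr ha.2; positivity
      have : ContinuousAt (fun s ↦ f s n) 1 := by
        have h3 := (Real.continuousAt_const_rpow (b := 1) h1)
        have h4 := (Real.continuousAt_const_rpow (b := 1) h2)
        refine ContinuousAt.div_const (ContinuousAt.sub (continuousAt_const.div h3 ?_)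
          (continuousAt_const.div h4 ?_)) 2 <;> simpa
      exact this.tendsto.mono_left nhdsWithin_le_nhds
    · filter_upwards [Ioo_mem_nhdsGT one_lt_two] with s hs
      exact hle ⟨hs.1.le, hs.2.le⟩
  have hcont : Tendsto (fun s : ℝ ↦ HurwitzZeta.hurwitzZetaOdd a s) (𝓝[>] 1)
      (𝓝 (HurwitzZeta.hurwitzZetaOdd a 1)) := by
    have h := ((HurwitzZeta.differentiable_hurwitzZetaOdd a).continuous.comp
      Complex.continuous_ofReal).tendsto 1
    simpa [Function.comp_def] using h.mono_left nhdsWithin_le_nhds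
  have heq : (fun s : ℝ ↦ ((∑' n, f s n : ℝ) : ℂ)) =ᶠ[𝓝[>] 1]
      fun s : ℝ ↦ HurwitzZeta.hurwitzZetaOdd a s := by
    filter_upwards [self_mem_nhdsWithin] with s hs
    rw [← (HurwitzZeta.hasSum_nat_hurwitzZetaOdd_of_mem_Icc ⟨ha.1.le, ha.2.le⟩
      (s := s) (by simpa using hs)).tsum_eq, Complex.ofReal_tsum]
    refine tsum_congr fun n ↦ ?_
    have h1 : (0 : ℝ) ≤ n + a := by have := ha.1; positivity
    have h2 : (0 : ℝ) ≤ n + (1 - a) := by have := sub_pos.mpr ha.2; positivity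
    simp only [f]
    push_cast [Complex.ofReal_cpow h1, Complex.ofReal_cpow h2]
    rw [add_sub_assoc]
  have hval := tendsto_nhds_unique (hcont.congr' heq.symm)
    ((Complex.continuous_ofReal.tendsto _).comp hlim)
  rw [hval]
  have hsum : Summable (f 1) := hbound.of_norm_bounded (hle ⟨le_rfl, one_le_two⟩)
  have hpartial := (Complex.continuous_ofReal.tendsto _).comp hsum.hasSum.tendsto_sum_nat
  refine tendsto_nhds_unique hpartial ?_
  have hacompl : (a : ℂ) ∈ Complex.integerComplement := by
    rintro ⟨k, hk⟩
    have : (k : ℝ) = a := by exact_mod_cast hk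
    have h1 : 0 < k := by exact_mod_cast this ▸ ha.1
    have h2 : k < 1 := by exact_mod_cast this ▸ ha.2
    lia
  have hcot := tendsto_logDeriv_euler_cot_sub hacompl
  have hzero : Tendsto (fun N : ℕ ↦ 1 / (a + N : ℂ)) atTop (𝓝 0) := by
    have : Tendsto (fun N : ℕ ↦ 1 / (a + N : ℝ)) atTop (𝓝 0) :=
      tendsto_const_nhds.div_atTop (tendsto_atTop_add_const_left _ a tendsto_natCast_atTop_atTop)
    simpa [Function.comp_def] using (Complex.continuous_ofReal.tendsto 0).comp this
  have := ((hcot.add_const (1 / (a : ℂ))).sub hzero).div_const 2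
  convert! this using 2 with N
  · rw [Function.comp_apply]
    induction N with
    | zero => simp
    | succ N ih =>
      have h1 : (a + N : ℂ) ≠ 0 := by
        have : a + N ≠ 0 := by have := ha.1; positivity
        exact_mod_cast this
      rw [Finset.sum_range_succ, Complex.ofReal_add, ih, Finset.sum_range_succ]
      simp only [f, Real.rpow_one, cotTerm]
      push_cast
      have h2 : (N + (1 - a) : ℂ) = -(a - (N + 1)) := by ring
      rw [h2, div_neg, add_comm (N : ℂ) a]
      ring
  · ring

end Cotangent

section LFunctionOne

open ZMod

variable {p : ℕ} [Fact p.Prime]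

theorem val_sub_one_eq (b : ZMod p) : ((b - 1).val : ℤ) = b.val - 1 + if b = 0 then p else 0 := by
  have hp : 1 < p := (Fact.out : p.Prime).one_lt
  have := Fact.mk hp
  split_ifs with h
  · subst h
    obtain ⟨n, rfl⟩ : ∃ n, p = n.succ := ⟨p - 1, by lia⟩
    rw [zero_sub, ZMod.val_neg_one, ZMod.val_zero]
    push_cast
    ring
  · have h1 : (1 : ZMod p).val ≤ b.val := by
      rw [ZMod.val_one p]
      exact Nat.one_le_iff_ne_zero.mpr ((ZMod.val_ne_zero b).mpr h)
    rw [ZMod.val_sub h1, Nat.cast_sub h1, ZMod.val_one p]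
    simp

theorem stdAddChar_sub_one_mul_sum {j : ZMod p} (hj : j ≠ 0) :
    (stdAddChar j - 1) * ∑ b : ZMod p, (b.val : ℂ) * stdAddChar (b * j) = p := by
  have hshift : stdAddChar j * ∑ b : ZMod p, (b.val : ℂ) * stdAddChar (b * j) =
      ∑ b : ZMod p, ((b - 1).val : ℂ) * stdAddChar (b * j) := by
    rw [Finset.mul_sum]
    refine Fintype.sum_equiv (Equiv.addRight 1) _ _ fun b ↦ ?_
    rw [Equiv.coe_addRight, add_sub_cancel_right, add_mul, one_mul, AddChar.map_add_eq_mul]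
    ring
  have hval (b : ZMod p) : ((b - 1).val : ℂ) = b.val - 1 + if b = 0 then (p : ℂ) else 0 := by
    have := congrArg (Int.cast : ℤ → ℂ) (val_sub_one_eq b)
    push_cast at this
    exact this
  have hsum := AddChar.sum_mulShift j (isPrimitive_stdAddChar p)
  rw [if_neg hj, Nat.cast_zero] at hsum
  rw [sub_mul, one_mul, hshift, ← Finset.sum_sub_distrib]
  calc ∑ b : ZMod p, (((b - 1).val : ℂ) * stdAddChar (b * j) - b.val * stdAddChar (b * j))
      = ∑ b : ZMod p, ((if b = 0 then (p : ℂ) * stdAddChar (b * j) else 0) -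
          stdAddChar (b * j)) := by
        refine Finset.sum_congr rfl fun b _ ↦ ?_
        rw [hval]
        split_ifs <;> ring
    _ = p := by
        rw [Finset.sum_sub_distrib, hsum]
        simp

theorem hurwitzZetaOdd_toAddCircle_one {j : ZMod p} (hj : j ≠ 0) :
    HurwitzZeta.hurwitzZetaOdd (toAddCircle j) 1 = Real.pi * Complex.I / 2 *
      (1 + 2 / p * ∑ b : ZMod p, (b.val : ℂ) * stdAddChar (b * j)) := by
  have hp0 : (p : ℂ) ≠ 0 := Nat.cast_ne_zero.mpr (NeZero.ne p)
  have hmem : (j.val / p : ℝ) ∈ Set.Ioo 0 1 := by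
    have hp : (0 : ℝ) < p := by exact_mod_cast (NeZero.pos p)
    have h0 : (0 : ℝ) < j.val := by exact_mod_cast Nat.pos_of_ne_zero ((ZMod.val_ne_zero j).mpr hj)
    refine ⟨by positivity, (div_lt_one hp).mpr ?_⟩
    exact_mod_cast ZMod.val_lt j
  have hexp : Complex.exp (2 * Real.pi * Complex.I * ((j.val / p : ℝ) : ℂ)) = stdAddChar j := by
    have := stdAddChar_coe (N := p) j.val
    rw [Int.cast_natCast, ZMod.natCast_zmod_val] at this
    rw [this]
    push_cast
    ring_nf
  have hne : stdAddChar j - 1 ≠ 0 := by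
    refine sub_ne_zero.mpr fun h ↦ hj (injective_stdAddChar ?_)
    rw [h, AddChar.map_zero_eq_one]
  have hne' : 1 - stdAddChar j ≠ 0 := fun h ↦ hne (by linear_combination -h)
  have hsum := stdAddChar_sub_one_mul_sum hj
  rw [toAddCircle_apply, hurwitzZetaOdd_one hmem, Complex.cot_pi_eq_exp_ratio, hexp]
  set T := ∑ b : ZMod p, (b.val : ℂ) * stdAddChar (b * j)
  set z := stdAddChar j
  have hI := Complex.I_mul_I
  have hI0 := Complex.I_ne_zero
  have hT : T = p / (z - 1) := by rw [eq_div_iff hne]; linear_combination hsum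
  rw [hT]
  field_simp
  linear_combination (z ^ 2 - 1) * hI

theorem LFunction_one_of_odd {χ : DirichletCharacter ℂ p} (hχ : χ.Odd) :
    χ.LFunction 1 = Real.pi * Complex.I / p ^ 2 *
      gaussSum χ stdAddChar * ∑ b : ZMod p, (b.val : ℂ) * χ⁻¹ b := by
  have hp0 : (p : ℂ) ≠ 0 := Nat.cast_ne_zero.mpr (NeZero.ne p)
  have hodd : Function.Odd (χ : ZMod p → ℂ) := fun j ↦ by
    rw [← neg_one_mul, map_mul, show χ (-1) = -1 from hχ, neg_one_mul]
  have hχ1 : χ ≠ 1 := by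
    rintro rfl
    rw [DirichletCharacter.Odd, MulChar.one_apply isUnit_one.neg] at hχ
    norm_num at hχ
  have hsum : ∑ j : ZMod p, χ j = 0 := MulChar.sum_eq_zero_of_ne_one hχ1
  have hgauss (b : ZMod p) :
      ∑ j : ZMod p, χ j * stdAddChar (b * j) = χ⁻¹ b * gaussSum χ stdAddChar := by
    by_cases hb : b = 0
    · subst hb
      simp [hsum, MulChar.map_zero]
    · exact gaussSum_mulShift_eq χ stdAddChar (Units.mk0 b hb)
  have hterm (j : ZMod p) : χ j * HurwitzZeta.hurwitzZetaOdd (toAddCircle j) 1 =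
      Real.pi * Complex.I / 2 * (χ j + 2 / p * ∑ b : ZMod p, (b.val : ℂ) *
        (χ j * stdAddChar (b * j))) := by
    by_cases hj : j = 0
    · subst hj
      simp [MulChar.map_zero]
    · rw [hurwitzZetaOdd_toAddCircle_one hj, ← mul_assoc, mul_comm (χ j), mul_assoc, mul_add,
        mul_one, mul_left_comm (χ j), Finset.mul_sum]
      simp only [mul_left_comm (χ j)]
  rw [DirichletCharacter.LFunction, LFunction_def_odd hodd]
  simp only [hterm]
  rw [← Finset.mul_sum, Finset.sum_add_distrib, hsum, zero_add, ← Finset.mul_sum,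
    Finset.sum_comm]
  simp only [← Finset.mul_sum, hgauss]
  rw [Complex.cpow_neg_one, Finset.mul_sum, Finset.mul_sum, Finset.mul_sum, Finset.mul_sum]
  refine Finset.sum_congr rfl fun b _ ↦ ?_
  field_simp

end LFunctionOne

section EulerOperator

open Polynomial

/-- The Euler operator `f ↦ X f'` on polynomials. -/
noncomputable def eulerOperator (R : Type*) [CommRing R] : Module.End R R[X] :=
  LinearMap.mulLeft R X ∘ₗ derivative

lemma eulerOperator_apply {R : Type*} [CommRing R] (f : R[X]) :
    eulerOperator R f = X * derivative f := rfl

lemma eval_eulerOperator_pow_X_sub_one_pow_mul {R : Type*} [CommRing R] (n : ℕ) (f : R[X]) :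
    ((eulerOperator R ^ n) ((X - 1) ^ n * f)).eval 1 = n.factorial * f.eval 1 := by
  induction n generalizing f with
  | zero => simp
  | succ n ih =>
    have h : eulerOperator R ((X - 1) ^ (n + 1) * f) =
        (X - 1) ^ n * ((n + 1 : R[X]) * X * f + X * (X - 1) * derivative f) := by
      rw [eulerOperator_apply, derivative_mul, derivative_pow_succ]
      simp
      ring
    rw [pow_succ, Module.End.mul_apply, h, ih, Nat.factorial_succ]
    simp
    ring

lemma eulerOperator_pow_sum {R ι : Type*} [CommRing R] (k : ℕ) (s : Finset ι) (c : ι → R)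
    (d : ι → ℕ) :
    (eulerOperator R ^ k) (∑ j ∈ s, C (c j) * X ^ d j) =
      ∑ j ∈ s, C (c j * (d j : R) ^ k) * X ^ d j := by
  induction k generalizing c with
  | zero => simp
  | succ k ih =>
    have h : eulerOperator R (∑ j ∈ s, C (c j) * X ^ d j) =
        ∑ j ∈ s, C (c j * (d j : R)) * X ^ d j := by
      rw [map_sum]
      refine Finset.sum_congr rfl fun j _ => ?_
      rw [eulerOperator_apply, derivative_C_mul_X_pow]
      rcases Nat.eq_zero_or_pos (d j) with h0 | h0
      · simp [h0]
      · rw [← Nat.sub_add_cancel h0]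
        simp
        ring
    rw [pow_succ, Module.End.mul_apply, h, ih]
    simp only [pow_succ', mul_assoc]

end EulerOperator

section GaussSumSign

open Polynomial

variable {p : ℕ} [Fact p.Prime]

lemma factorial_half_sq_mul_neg_one_pow (hp : p % 2 = 1) :
    ((p / 2).factorial : ZMod p) ^ 2 * (-1) ^ (p / 2) = -1 := by
  have h1 : p - 1 = p / 2 + p / 2 := by omega
  have h2 : ((p / 2).factorial : ZMod p) = ∏ j ∈ Finset.range (p / 2), ((j + 1 : ℕ) : ZMod p) := by
    rw [← Nat.cast_prod, Finset.prod_range_add_one_eq_factorial]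
  have h3 : ∀ j ∈ Finset.range (p / 2),
      ((p / 2 + (p / 2 - 1 - j) + 1 : ℕ) : ZMod p) = -1 * ((j + 1 : ℕ) : ZMod p) := by
    intro j hj
    rw [Finset.mem_range] at hj
    have h4 : p / 2 + (p / 2 - 1 - j) + 1 + (j + 1) = p := by omega
    have h5 := congrArg (Nat.cast : ℕ → ZMod p) h4
    rw [Nat.cast_add, CharP.cast_eq_zero (ZMod p) p] at h5
    linear_combination h5
  have h6 : ∏ j ∈ Finset.range (p / 2), ((p / 2 + j + 1 : ℕ) : ZMod p) =
      (-1) ^ (p / 2) * ((p / 2).factorial : ZMod p) := by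
    rw [← Finset.prod_range_reflect, Finset.prod_congr rfl h3, Finset.prod_mul_distrib, ← h2,
      Finset.prod_const, Finset.card_range]
  have h7 := ZMod.wilsons_lemma p
  rw [← Finset.prod_range_add_one_eq_factorial (p - 1), h1, Finset.prod_range_add, Nat.cast_mul,
    Nat.cast_prod, Nat.cast_prod, h6, ← h2] at h7
  linear_combination h7

lemma sum_zmod_eq_sum_range {A : Type*} [AddCommMonoid A] (F : ZMod p → A) :
    ∑ x, F x = ∑ j ∈ Finset.range p, F (j : ZMod p) := by
  refine Finset.sum_nbij' ZMod.val (fun j => (j : ZMod p)) ?_ ?_ ?_ ?_ ?_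
  · intro x _; exact Finset.mem_range.2 (ZMod.val_lt x)
  · simp
  · intro x _; simp
  · intro j hj; exact ZMod.val_cast_of_lt (Finset.mem_range.1 hj)
  · intro x _; simp

lemma sum_range_pow_sub_one : ∑ j ∈ Finset.range p, (j : ZMod p) ^ (p - 1) = -1 := by
  rw [← sum_zmod_eq_sum_range (fun x : ZMod p => x ^ (p - 1))]
  have hp := (Fact.out : p.Prime).two_le
  have h : ∀ x : ZMod p, x ^ (p - 1) = 1 - if x = 0 then 1 else 0 := by
    intro x
    split_ifs with hx
    · rw [hx, zero_pow (by omega)]; ring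
    · rw [ZMod.pow_card_sub_one_eq_one hx]; ring
  simp [h]

/-- The polynomial whose vanishing at `exp (2πi / p)` would mean that the quadratic Gauss sum has
the wrong sign. -/
noncomputable def wrongSignPoly (p s : ℕ) [Fact p.Prime] : ℤ[X] :=
  ∑ j ∈ Finset.range p, C (legendreSym p j) * X ^ j +
    X ^ s * ∏ k ∈ Finset.range (p / 2), (1 - X ^ (k + 1))

lemma not_cyclotomic_dvd_wrongSignPoly (hp : p % 2 = 1) (s : ℕ) :
    ¬ cyclotomic p ℤ ∣ wrongSignPoly p s := by
  intro hdvd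
  have hp3 : 3 ≤ p := by have := (Fact.out : p.Prime).two_le; omega
  have h1 : cyclotomic p (ZMod p) = (X - 1) ^ (p - 1) := by
    have := cyclotomic_mul_prime_eq_pow_of_not_dvd (ZMod p) (p := p) (n := 1)
      (by rw [Nat.dvd_one]; omega)
    rwa [one_mul, cyclotomic_one] at this
  have h2 : (X - 1 : (ZMod p)[X]) ^ (p / 2 + 1) ∣
      (wrongSignPoly p s).map (Int.castRingHom (ZMod p)) := by
    refine (pow_dvd_pow _ (by omega : p / 2 + 1 ≤ p - 1)).trans ?_
    rw [← h1, ← map_cyclotomic p (Int.castRingHom (ZMod p))]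
    exact Polynomial.map_dvd _ hdvd
  obtain ⟨g, hg⟩ := h2
  have h3 : ((eulerOperator (ZMod p) ^ (p / 2))
      ((wrongSignPoly p s).map (Int.castRingHom (ZMod p)))).eval 1 = 0 := by
    rw [hg, pow_succ, mul_assoc, eval_eulerOperator_pow_X_sub_one_pow_mul]
    simp
  have h4 : (wrongSignPoly p s).map (Int.castRingHom (ZMod p)) =
      ∑ j ∈ Finset.range p, C ((j : ZMod p) ^ (p / 2)) * X ^ j +
      (X - 1) ^ (p / 2) *
        (X ^ s * ∏ k ∈ Finset.range (p / 2), (-∑ i ∈ Finset.range (k + 1), X ^ i)) := by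
    have h5 : ∏ k ∈ Finset.range (p / 2), (1 - X ^ (k + 1) : (ZMod p)[X]) =
        (X - 1) ^ (p / 2) *
          ∏ k ∈ Finset.range (p / 2), (-∑ i ∈ Finset.range (k + 1), (X : (ZMod p)[X]) ^ i) := by
      have h6 : (X - 1 : (ZMod p)[X]) ^ (p / 2) = ∏ k ∈ Finset.range (p / 2), (X - 1) := by simp
      rw [h6, ← Finset.prod_mul_distrib]
      refine Finset.prod_congr rfl fun k _ => ?_
      linear_combination (geom_sum_mul (X : (ZMod p)[X]) (k + 1))
    simp only [wrongSignPoly, Polynomial.map_add, Polynomial.map_mul, Polynomial.map_sum,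
      Polynomial.map_prod, Polynomial.map_pow, map_X, map_C, Polynomial.map_sub,
      Polynomial.map_one, h5]
    congr 1
    · refine Finset.sum_congr rfl fun j _ => ?_
      simp [legendreSym.eq_pow]
    · ring
  rw [h4, map_add, eval_add, eval_eulerOperator_pow_X_sub_one_pow_mul, eulerOperator_pow_sum] at h3
  have h6 : p / 2 + p / 2 = p - 1 := by omega
  simp only [← pow_add, h6, eval_finsetSum, eval_mul, eval_C, eval_pow, eval_X, one_pow,
    mul_one, sum_range_pow_sub_one, one_mul, eval_prod, eval_neg, Finset.sum_const,
    Finset.card_range, nsmul_eq_mul, Finset.prod_neg] at h3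
  rw [← Nat.cast_prod, Finset.prod_range_add_one_eq_factorial] at h3
  have h7 := factorial_half_sq_mul_neg_one_pow hp
  have h8 : (-2 : ZMod p) = 0 := by rw [eval_one] at h3; linear_combination h3 - h7
  have h9 : ((2 : ℕ) : ZMod p) = 0 := by push_cast; linear_combination -h8
  rw [ZMod.natCast_eq_zero_iff] at h9
  have := Nat.le_of_dvd (by norm_num) h9
  omega

end GaussSumSign

section GaussSumValue

open Polynomial Complex ZMod

variable {p : ℕ}

lemma prod_neg_one_pow_mul_neg_I (n : ℕ) :
    ∏ k ∈ Finset.range (2 * n + 1), ((-1 : ℂ) ^ (k + 1) * -I) = I := by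
  induction n with
  | zero => simp
  | succ n ih =>
    rw [show 2 * (n + 1) + 1 = 2 * n + 1 + 1 + 1 by ring, Finset.prod_range_succ,
      Finset.prod_range_succ, ih]
    have h : ((-1 : ℂ) ^ n) ^ 2 = 1 := by rw [← pow_mul, mul_comm, pow_mul]; simp
    linear_combination (-(I ^ 3) * (((-1 : ℂ) ^ n) ^ 2 + 1)) * h - I * I_sq

lemma two_sin_mul_I (x : ℝ) :
    ((2 * Real.sin x : ℝ) : ℂ) * I = exp (x * I) - (exp (x * I))⁻¹ := by
  rw [← exp_neg, exp_mul_I, ← neg_mul, exp_mul_I]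
  simp
  ring

lemma exp_two_pi_div_pow (k : ℕ) :
    exp (2 * Real.pi * I / p) ^ k = exp ((Real.pi * k / p : ℝ) * I) ^ 2 := by
  rw [← exp_nat_mul, ← exp_nat_mul]
  congr 1
  push_cast
  ring

lemma prod_two_sin_eq_sqrt (hp : p % 2 = 1) :
    ∏ k ∈ Finset.range (p / 2), (2 * Real.sin (Real.pi * (k + 1 : ℕ) / p)) = √p := by
  have hp0 : (0 : ℝ) < p := by
    have : 0 < p := by omega
    exact_mod_cast this
  have hpos : 0 ≤ ∏ k ∈ Finset.range (p / 2), (2 * Real.sin (Real.pi * (k + 1 : ℕ) / p)) := by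
    refine Finset.prod_nonneg fun k hk => ?_
    rw [Finset.mem_range] at hk
    have hk' : ((k + 1 : ℕ) : ℝ) ≤ p := by exact_mod_cast (by omega : k + 1 ≤ p)
    refine mul_nonneg (by norm_num) (Real.sin_nonneg_of_nonneg_of_le_pi (by positivity) ?_)
    rw [div_le_iff₀ hp0]
    gcongr
  rw [eq_comm, Real.sqrt_eq_iff_mul_self_eq hp0.le hpos, ← Finset.prod_mul_distrib]
  symm
  have hζ := Complex.isPrimitiveRoot_exp (p - 1 + 1) (by omega)
  have h := hζ.prod_one_sub_pow_eq_order
  rw [show p - 1 = p / 2 + p / 2 by omega, Finset.prod_range_add,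
    ← Finset.prod_range_reflect (fun j => 1 - _ ^ (p / 2 + j + 1)), ← Finset.prod_mul_distrib,
    show p / 2 + p / 2 + 1 = p by omega] at h
  rw [← ofReal_inj, ofReal_natCast, ofReal_prod]
  trans (((p / 2 + p / 2 : ℕ) : ℂ) + 1)
  swap
  · exact_mod_cast (by omega : p / 2 + p / 2 + 1 = p)
  rw [← h]
  refine Finset.prod_congr rfl fun k hk => ?_
  rw [Finset.mem_range] at hk
  have h1 : exp (2 * Real.pi * I / p) ^ (p / 2 + (p / 2 - 1 - k) + 1) *
      exp (2 * Real.pi * I / p) ^ (k + 1) = 1 := by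
    rw [← pow_add, show p / 2 + (p / 2 - 1 - k) + 1 + (k + 1) = p by omega]
    exact (Complex.isPrimitiveRoot_exp p (by omega)).pow_eq_one
  rw [exp_two_pi_div_pow (k + 1)] at h1 ⊢
  have h2 := two_sin_mul_I (Real.pi * (k + 1 : ℕ) / p)
  have h3 := exp_ne_zero (((Real.pi * (k + 1 : ℕ) / p : ℝ) : ℂ) * I)
  set w := exp (((Real.pi * (k + 1 : ℕ) / p : ℝ) : ℂ) * I)
  rw [eq_inv_of_mul_eq_one_left h1, ofReal_mul]
  generalize ((2 * Real.sin (Real.pi * (k + 1 : ℕ) / p) : ℝ) : ℂ) = t at h2 ⊢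
  have h5 : t * t = - (t * I) ^ 2 := by linear_combination t ^ 2 * I_sq
  rw [h5, h2]
  field_simp
  ring

lemma prod_exp_eq_I_mul_sqrt (hp4 : p % 4 = 3) :
    ∏ k ∈ Finset.range (p / 2), (exp (2 * Real.pi * I / p) ^ (p / 2 * (k + 1)) *
      (1 - exp (2 * Real.pi * I / p) ^ (k + 1))) = I * √p := by
  have hp0 : (p : ℂ) ≠ 0 := by exact_mod_cast (by omega : p ≠ 0)
  rw [← prod_two_sin_eq_sqrt (by omega), ofReal_prod]
  have h1 := prod_neg_one_pow_mul_neg_I (p / 4)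
  rw [show 2 * (p / 4) + 1 = p / 2 by omega] at h1
  conv_rhs => rw [← h1]
  rw [← Finset.prod_mul_distrib]
  refine Finset.prod_congr rfl fun k _ => ?_
  have h2 := two_sin_mul_I (Real.pi * (k + 1 : ℕ) / p)
  have h3 := exp_ne_zero (((Real.pi * (k + 1 : ℕ) / p : ℝ) : ℂ) * I)
  have h4 : exp (2 * Real.pi * I / p) ^ (p / 2 * (k + 1)) *
      exp (((Real.pi * (k + 1 : ℕ) / p : ℝ) : ℂ) * I) = (-1) ^ (k + 1) := by
    rw [← exp_pi_mul_I, ← exp_nat_mul, ← exp_nat_mul, ← exp_add]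
    congr 1
    have h5 : (p : ℂ) = 2 * (p / 2 : ℕ) + 1 := by exact_mod_cast (by omega : p = 2 * (p / 2) + 1)
    push_cast
    field_simp
    linear_combination -h5
  rw [exp_two_pi_div_pow (k + 1)]
  set w := exp (((Real.pi * (k + 1 : ℕ) / p : ℝ) : ℂ) * I)
  have h6 : w * w⁻¹ = 1 := mul_inv_cancel₀ h3
  rw [← h4]
  linear_combination exp (2 * Real.pi * I / p) ^ (p / 2 * (k + 1)) * (w * h2 - h6)

variable [Fact p.Prime]

lemma gaussSum_legendreChar_eq_sum :
    gaussSum (legendreChar p) stdAddChar =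
      ∑ j ∈ Finset.range p, (legendreSym p j : ℂ) * exp (2 * Real.pi * I / p) ^ j := by
  rw [gaussSum, sum_zmod_eq_sum_range (fun x => legendreChar p x * stdAddChar x)]
  refine Finset.sum_congr rfl fun j _ => ?_
  rw [legendreChar_natCast]
  congr 1
  have := stdAddChar_coe (N := p) (j : ℤ)
  rw [Int.cast_natCast] at this
  rw [this, ← exp_nat_mul]
  congr 1
  push_cast
  ring

lemma isQuadratic_legendreChar : (legendreChar p).IsQuadratic :=
  (quadraticChar_isQuadratic (ZMod p)).comp _

theorem gaussSum_legendreChar (hp4 : p % 4 = 3) :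
    gaussSum (legendreChar p) stdAddChar = I * √p := by
  have h1 : gaussSum (legendreChar p) stdAddChar ^ 2 = (I * √p) ^ 2 := by
    rw [gaussSum_sq (χ := legendreChar p) (legendreChar_ne_one hp4) isQuadratic_legendreChar
      (isPrimitive_stdAddChar p), odd_legendreChar hp4, ZMod.card, mul_pow, I_sq, ← ofReal_pow,
      Real.sq_sqrt (Nat.cast_nonneg p), ofReal_natCast]
  refine (sq_eq_sq_iff_eq_or_eq_neg.1 h1).resolve_right fun h2 => ?_
  refine not_cyclotomic_dvd_wrongSignPoly (p := p) (by omega)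
    (∑ k ∈ Finset.range (p / 2), p / 2 * (k + 1)) ?_
  have hζ := Complex.isPrimitiveRoot_exp p (by omega)
  rw [cyclotomic_eq_minpoly hζ (by omega)]
  refine minpoly.isIntegrallyClosed_dvd (hζ.isIntegral (by omega)) ?_
  rw [wrongSignPoly, map_add, map_mul, map_sum, map_prod, map_pow, aeval_X,
    ← Finset.prod_pow_eq_pow_sum, ← Finset.prod_mul_distrib]
  simp only [map_mul, map_sub, map_pow, aeval_X, map_one, eq_intCast, map_intCast]
  rw [prod_exp_eq_I_mul_sqrt hp4, ← gaussSum_legendreChar_eq_sum, h2]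
  ring

end GaussSumValue

/-- Dirichlet's class number formula for `ℚ(√-p)`, `p ≡ 3 (mod 4)`, `p > 3`. -/
theorem sum_mul_legendreSym_eq {p : ℕ} [Fact p.Prime] (hp4 : p % 4 = 3) (hp : 3 < p)
    {K : Type*} [Field K] [NumberField K] {α : K} (hα : α ^ 2 = -(p : K))
    (hgen : Algebra.adjoin ℚ ({α} : Set K) = ⊤) :
    ∑ j ∈ Finset.range p, (j : ℤ) * legendreSym p j = -(p * NumberField.classNumber K) := by
  obtain ⟨b, h0, h1⟩ := exists_integral_basis Fact.out hp4 hα hgen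
  have := isTotallyComplex_of_sq_eq_neg hα (by omega)
  have h2 := LFunction_legendreChar_one h0 h1 (p := p) (by omega) (by omega)
  have hinv : (legendreChar p)⁻¹ = legendreChar p := isQuadratic_legendreChar.inv
  rw [LFunction_one_of_odd (odd_legendreChar hp4), gaussSum_legendreChar hp4, hinv,
    sum_zmod_eq_sum_range (fun b : ZMod p => (b.val : ℂ) * legendreChar p b)] at h2
  have h3 : ∑ j ∈ Finset.range p, (((j : ZMod p).val : ℂ) * legendreChar p j) =
      ((∑ j ∈ Finset.range p, (j : ℤ) * legendreSym p j : ℤ) : ℂ) := by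
    push_cast
    refine Finset.sum_congr rfl fun j hj => ?_
    rw [ZMod.val_cast_of_lt (Finset.mem_range.1 hj), legendreChar_natCast]
  rw [h3] at h2
  set S : ℤ := ∑ j ∈ Finset.range p, (j : ℤ) * legendreSym p j
  have hp0 : (p : ℂ) ≠ 0 := by exact_mod_cast (by omega : p ≠ 0)
  have hπ : (Real.pi : ℂ) ≠ 0 := by exact_mod_cast Real.pi_ne_zero
  have hsq : ((√p : ℝ) : ℂ) ^ 2 = p := by
    rw [← Complex.ofReal_pow, Real.sq_sqrt (Nat.cast_nonneg p), Complex.ofReal_natCast]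
  have hs0 : ((√p : ℝ) : ℂ) ≠ 0 := fun h => hp0 (by rw [← hsq, h]; simp)
  field_simp at h2
  rw [hsq, Complex.I_sq] at h2
  have h4 : (S : ℂ) = -(p * NumberField.classNumber K) := by
    apply mul_left_cancel₀ hp0
    linear_combination -h2
  exact_mod_cast h4

/-- For a prime `p > 3` with `p ≡ 3 (mod 4)` and `h` the class number of `ℚ(√-p)` (formalized
as a number field `K` generated over `ℚ` by a square root `α` of `-p`), the sum of `a/p` over
the quadratic residues `a` modulo `p` with `1 ≤ a ≤ p-1` equals `(p-1)/4 - h/2`. -/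
theorem sum_quadratic_residues_div (p : ℕ) [Fact p.Prime]
    (hp4 : p % 4 = 3) (hp : 3 < p)
    (K : Type) [Field K] [NumberField K] (α : K)
    (hα : α ^ 2 = -(p : K)) (hgen : Algebra.adjoin ℚ ({α} : Set K) = ⊤) :
    ∑ a ∈ (Finset.Icc 1 (p - 1)).filter (fun a : ℕ => legendreSym p a = 1), ((a : ℚ) / p)
      = ((p : ℚ) - 1) / 4 - (NumberField.classNumber K : ℚ) / 2 := by
  have hS := congrArg (Int.cast : ℤ → ℚ) (sum_mul_legendreSym_eq hp4 hp hα hgen)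
  have hp0 : (p : ℚ) ≠ 0 := by exact_mod_cast (by omega : p ≠ 0)
  have hG : (∑ j ∈ Finset.range p, (j : ℚ)) * 2 = p * (p - 1) := by
    have := congrArg (Nat.cast : ℕ → ℚ) (Finset.sum_range_id_mul_two p)
    push_cast [Nat.cast_sub (by omega : 1 ≤ p)] at this
    exact this
  have hR : ∑ a ∈ (Finset.Icc 1 (p - 1)).filter (fun a : ℕ => legendreSym p a = 1),
      ((a : ℚ) / p) = ∑ j ∈ Finset.range p, ((j : ℚ) + j * legendreSym p j) / (2 * p) := by
    have hIcc : Finset.range p = insert 0 (Finset.Icc 1 (p - 1)) := by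
      ext j
      simp only [Finset.mem_range, Finset.mem_insert, Finset.mem_Icc]
      omega
    rw [hIcc, Finset.sum_insert (by simp), Finset.sum_filter]
    simp only [Nat.cast_zero, zero_mul, add_zero, zero_div, zero_add]
    refine Finset.sum_congr rfl fun j hj => ?_
    rw [Finset.mem_Icc] at hj
    have hj0 : ((j : ℤ) : ZMod p) ≠ 0 := by
      rw [Int.cast_natCast, Ne, ZMod.natCast_eq_zero_iff]
      exact fun h => absurd (Nat.le_of_dvd (by omega) h) (by omega)
    rcases legendreSym.eq_one_or_neg_one p hj0 with h | h
    · rw [if_pos h, h]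
      push_cast
      field_simp
      ring
    · rw [if_neg (by rw [h]; decide), h]
      simp
  push_cast at hS
  rw [hR, ← Finset.sum_div, Finset.sum_add_distrib, hS]
  field_simp
  linear_combination 2 * hG
end

section
/- Let p > 3 be a prime with p ≡ 3 (mod 4), let k = ℚ(√-p) with a fixed embedding k ↪ ℂ, and set n = (p-1)/2. Let r, s, t be integers with 0 < r, s, t < p and r + s + t = p. Then there exists a nonzero element z of k (viewed in ℂ) such that Π_{1≤a≤p-1, (a|p)=+1} B(⟨ar/p⟩, ⟨as/p⟩) = z · (2πi)^{-n} · Π_{1≤a≤p-1, (a|p)=+1} Γ(⟨ar/p⟩)·Γ(⟨as/p⟩)·Γ(⟨at/p⟩), where B(u,v) = ∫_0^1 x^{u-1}(1-x)^{v-1} dx is Euler's beta function. -/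
open Finset in
/-- If `-1` is not a square mod `p`, the reflection `a ↦ p - a` exchanges the quadratic residues
and the non-residues. -/
theorem prod_Icc_eq_prod_residues_mul_reflect {M : Type*} [CommMonoid M] (p : ℕ) [Fact p.Prime]
    (hp4 : p % 4 = 3) (f : ℕ → M) :
    ∏ a ∈ Icc 1 (p - 1), f a =
      (∏ a ∈ (Icc 1 (p - 1)).filter (fun a : ℕ => legendreSym p a = 1), f a) *
        ∏ a ∈ (Icc 1 (p - 1)).filter (fun a : ℕ => legendreSym p a = 1), f (p - a) := by
  have hreflect : ∀ a ∈ Icc 1 (p - 1), legendreSym p ((p - a : ℕ) : ℤ) = -legendreSym p a := by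
    intro a ha
    rw [mem_Icc] at ha
    have h1 : legendreSym p (-1) = -1 := by
      rw [legendreSym.at_neg_one (by omega), ZMod.χ₄_nat_three_mod_four hp4]
    rw [Nat.cast_sub (by omega), legendreSym.mod, Int.sub_emod, Int.emod_self,
      ← Int.zero_emod p, ← Int.sub_emod, ← legendreSym.mod, zero_sub, neg_eq_neg_one_mul,
      legendreSym.mul, h1, neg_one_mul]
  have hvalue : ∀ a ∈ Icc 1 (p - 1), legendreSym p a = 1 ∨ legendreSym p a = -1 := by
    intro a ha
    rw [mem_Icc] at ha
    apply legendreSym.eq_one_or_neg_one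
    rw [Int.cast_natCast, Ne, ZMod.natCast_eq_zero_iff]
    exact Nat.not_dvd_of_pos_of_lt (by omega) (by omega)
  rw [← prod_filter_mul_prod_filter_not (Icc 1 (p - 1)) (fun a : ℕ => legendreSym p a = 1)]
  congr 1
  refine prod_nbij' (fun a => p - a) (fun a => p - a) ?_ ?_ ?_ ?_ ?_
  · intro a ha
    rw [mem_filter] at ha ⊢
    have h := hreflect a ha.1
    have h' := hvalue a ha.1
    rw [mem_Icc] at ha ⊢
    grind
  · intro a ha
    rw [mem_filter] at ha ⊢
    have h := hreflect a ha.1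
    rw [mem_Icc] at ha ⊢
    grind
  · intro a ha
    rw [mem_filter, mem_Icc] at ha
    show p - (p - a) = a
    omega
  · intro a ha
    rw [mem_filter, mem_Icc] at ha
    show p - (p - a) = a
    omega
  · intro a ha
    rw [mem_filter, mem_Icc] at ha
    rw [Nat.sub_sub_self (by omega)]

open Finset in
theorem card_filter_legendreSym_eq_one (p : ℕ) [Fact p.Prime] (hp4 : p % 4 = 3) :
    ((Icc 1 (p - 1)).filter (fun a : ℕ => legendreSym p a = 1)).card = (p - 1) / 2 := by
  have h := prod_Icc_eq_prod_residues_mul_reflect p hp4 (fun _ => 2)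
  rw [prod_const, prod_const, ← pow_add, Nat.card_Icc] at h
  have := Nat.pow_right_injective le_rfl h
  omega

theorem sin_pi_mul_fract (y : ℝ) : Real.sin (Real.pi * Int.fract y) = |Real.sin (Real.pi * y)| := by
  have h0 : 0 ≤ Real.sin (Real.pi * Int.fract y) := by
    apply Real.sin_nonneg_of_nonneg_of_le_pi
    · exact mul_nonneg Real.pi_pos.le (Int.fract_nonneg y)
    · exact mul_le_of_le_one_right Real.pi_pos.le (Int.fract_lt_one y).le
  rw [← abs_of_nonneg h0, Int.fract, mul_sub, mul_comm Real.pi (⌊y⌋ : ℝ), Real.sin_sub_int_mul_pi,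
    abs_mul, abs_zpow, abs_neg, abs_one, one_zpow, one_mul]

theorem norm_one_sub_exp_two_pi_I_mul (y : ℝ) :
    ‖1 - Complex.exp (2 * Real.pi * Complex.I * y)‖ = 2 * |Real.sin (Real.pi * y)| := by
  have h := Complex.norm_exp_I_mul_ofReal_sub_one (2 * Real.pi * y)
  have hexp : Complex.I * ((2 * Real.pi * y : ℝ) : ℂ) = 2 * Real.pi * Complex.I * y := by
    push_cast
    ring
  have hsin : 2 * Real.pi * y / 2 = Real.pi * y := by ring
  rwa [hexp, hsin, norm_mul, Real.norm_eq_abs, Real.norm_eq_abs, abs_two, norm_sub_rev] at h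

open Finset in
theorem prod_two_mul_abs_sin (p t : ℕ) (hp : 0 < p) (hpt : t.Coprime p) :
    ∏ a ∈ Icc 1 (p - 1), (2 * |Real.sin (Real.pi * (a * t / p))|) = p := by
  obtain ⟨m, rfl⟩ : ∃ m, p = m + 1 := ⟨p - 1, by omega⟩
  have h := (Complex.isPrimitiveRoot_exp_of_coprime t (m + 1) (by omega)
    hpt).prod_one_sub_pow_eq_order
  have h' := congrArg norm h
  rw [norm_prod] at h'
  rw [Nat.add_sub_cancel, ← Finset.Ico_succ_right_eq_Icc, Finset.prod_Ico_eq_prod_range]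
  trans ‖(m : ℂ) + 1‖
  · rw [← h']
    refine prod_congr rfl fun a _ => ?_
    rw [← norm_one_sub_exp_two_pi_I_mul, ← Complex.exp_nat_mul]
    congr 3
    push_cast
    ring
  · exact_mod_cast Complex.norm_natCast (m + 1)

open Finset in
theorem prod_residues_two_mul_sin (p t : ℕ) [hpp : Fact p.Prime] (hp4 : p % 4 = 3)
    (hpt : t.Coprime p) :
    ∏ a ∈ (Icc 1 (p - 1)).filter (fun a : ℕ => legendreSym p a = 1),
      (2 * Real.sin (Real.pi * Int.fract ((a * t : ℝ) / p))) = Real.sqrt p := by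
  have hp0 : (p : ℝ) ≠ 0 := Nat.cast_ne_zero.2 hpp.out.ne_zero
  simp_rw [sin_pi_mul_fract]
  symm
  rw [Real.sqrt_eq_iff_mul_self_eq (Nat.cast_nonneg p) (prod_nonneg fun _ _ => by positivity)]
  refine (prod_two_mul_abs_sin p t hpp.out.pos hpt).symm.trans ?_
  rw [prod_Icc_eq_prod_residues_mul_reflect p hp4]
  congr 1
  refine prod_congr rfl fun a ha => ?_
  rw [mem_filter, mem_Icc] at ha
  have h : Real.pi * (((p - a : ℕ) : ℝ) * t / p) = (t : ℤ) * Real.pi - Real.pi * (a * t / p) := by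
    rw [Nat.cast_sub (by omega)]
    push_cast
    field_simp
  rw [h, Real.sin_int_mul_pi_sub]
  simp [abs_mul]

/-- The beta function at `(x, y)` and the gamma factor at the third point `w` of a triple with
integral sum differ, by the reflection formula, by a rational multiple of `sin (π w) / π`. -/
theorem betaIntegral_eq_rat_mul_sin_mul_Gamma {x y : ℝ} {w : ℚ} (hx0 : 0 < x) (hx1 : x < 1)
    (hy0 : 0 < y) (hy1 : y < 1) (hw0 : 0 < w) (hw1 : w < 1) {m : ℤ} (h : x + y + w = m) :
    ∃ q : ℚ, q ≠ 0 ∧ Complex.betaIntegral x y =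
      q * (Real.sin (Real.pi * (w : ℝ)) / Real.pi) *
        (Complex.Gamma x * Complex.Gamma y * Complex.Gamma (w : ℝ)) := by
  have hw0' : (0 : ℝ) < w := by exact_mod_cast hw0
  have hw1' : (w : ℝ) < 1 := by exact_mod_cast hw1
  have hbeta := Complex.Gamma_mul_Gamma_eq_betaIntegral (s := (x : ℂ)) (t := (y : ℂ))
    (by simpa using hx0) (by simpa using hy0)
  have hrefl := Complex.Gamma_mul_Gamma_one_sub ((w : ℝ) : ℂ)
  have hsin : Complex.sin (Real.pi * ((w : ℝ) : ℂ)) ≠ 0 := by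
    exact_mod_cast (Real.sin_pos_of_pos_of_lt_pi (by positivity)
      (mul_lt_of_lt_one_right Real.pi_pos hw1')).ne'
  have hpi : (Real.pi : ℂ) ≠ 0 := by exact_mod_cast Real.pi_ne_zero
  have hG1 : Complex.Gamma (1 - ((w : ℝ) : ℂ)) ≠ 0 :=
    Complex.Gamma_ne_zero_of_re_pos (by simpa using hw1')
  rw [eq_div_iff hsin] at hrefl
  have hm : m = 1 ∨ m = 2 := by
    have h1 : (0 : ℝ) < m := by linarith
    have h2 : (m : ℝ) < 3 := by linarith
    have h1' : 0 < m := by exact_mod_cast h1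
    have h2' : m < 3 := by exact_mod_cast h2
    omega
  rcases hm with rfl | rfl
  · refine ⟨1, one_ne_zero, ?_⟩
    have hxy : (x : ℂ) + y = 1 - ((w : ℝ) : ℂ) := by
      rw [eq_sub_iff_add_eq]
      exact_mod_cast h
    rw [hxy] at hbeta
    apply mul_left_cancel₀ hG1
    rw [← hbeta, Complex.ofReal_sin, Complex.ofReal_mul]
    set σ := Complex.sin (Real.pi * ((w : ℝ) : ℂ))
    field_simp
    linear_combination (-Complex.Gamma x * Complex.Gamma y) * hrefl
  · refine ⟨1 / (1 - w), one_div_ne_zero (sub_pos.2 hw1).ne', ?_⟩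
    have h1w : (1 : ℂ) - ((w : ℝ) : ℂ) ≠ 0 := by
      exact_mod_cast (sub_pos.2 hw1').ne'
    have hxy : (x : ℂ) + y = 1 - ((w : ℝ) : ℂ) + 1 := by
      have : x + y = 1 - w + 1 := by push_cast at h; linarith
      exact_mod_cast this
    rw [hxy, Complex.Gamma_add_one _ h1w] at hbeta
    apply mul_left_cancel₀ (mul_ne_zero h1w hG1)
    rw [← hbeta, Complex.ofReal_sin, Complex.ofReal_mul]
    set σ := Complex.sin (Real.pi * ((w : ℝ) : ℂ))
    rw [Complex.ofReal_ratCast] at *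
    push_cast
    field_simp
    linear_combination (-Complex.Gamma x * Complex.Gamma y) * hrefl

theorem fract_natCast_mul_div_pos {p a t : ℕ} (hp : p.Prime) (ha : ¬ p ∣ a) (ht : ¬ p ∣ t) :
    0 < Int.fract ((a * t : ℝ) / p) := by
  refine lt_of_le_of_ne (Int.fract_nonneg _) fun h => ?_
  obtain ⟨k, hk⟩ := Int.fract_eq_zero_iff.1 h.symm
  have hp0 : (p : ℝ) ≠ 0 := Nat.cast_ne_zero.2 hp.ne_zero
  rw [eq_div_iff hp0] at hk
  have hk' : k * (p : ℤ) = ((a * t : ℕ) : ℤ) := by exact_mod_cast hk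
  have hdvd : p ∣ a * t := Int.natCast_dvd_natCast.1 (Dvd.intro_left k hk')
  exact (hp.dvd_mul.1 hdvd).elim ha ht

theorem betaIntegral_fract_eq {p a r s t : ℕ} (hp : p.Prime) (ha : ¬ p ∣ a) (hr : ¬ p ∣ r)
    (hs : ¬ p ∣ s) (ht : ¬ p ∣ t) (hsum : r + s + t = p) :
    ∃ q : ℚ, q ≠ 0 ∧
      Complex.betaIntegral ((Int.fract ((a * r : ℝ) / p) : ℝ) : ℂ)
          ((Int.fract ((a * s : ℝ) / p) : ℝ) : ℂ) =
        q * (Real.sin (Real.pi * Int.fract ((a * t : ℝ) / p)) / Real.pi) *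
          (Complex.Gamma ((Int.fract ((a * r : ℝ) / p) : ℝ) : ℂ)
            * Complex.Gamma ((Int.fract ((a * s : ℝ) / p) : ℝ) : ℂ)
            * Complex.Gamma ((Int.fract ((a * t : ℝ) / p) : ℝ) : ℂ)) := by
  have hp0 : (p : ℝ) ≠ 0 := Nat.cast_ne_zero.2 hp.ne_zero
  have hw : ((Int.fract ((a * t : ℚ) / p) : ℚ) : ℝ) = Int.fract ((a * t : ℝ) / p) := by
    push_cast
    rfl
  have hw0 := fract_natCast_mul_div_pos hp ha ht
  have hw1 := Int.fract_lt_one ((a * t : ℝ) / p)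
  rw [← hw] at hw0 hw1 ⊢
  refine betaIntegral_eq_rat_mul_sin_mul_Gamma (fract_natCast_mul_div_pos hp ha hr)
    (Int.fract_lt_one _) (fract_natCast_mul_div_pos hp ha hs) (Int.fract_lt_one _)
    (by exact_mod_cast hw0) (by exact_mod_cast hw1)
    (m := a - ⌊(a * r : ℝ) / p⌋ - ⌊(a * s : ℝ) / p⌋ - ⌊(a * t : ℝ) / p⌋) ?_
  have hsum' : (r + s + t : ℝ) = p := by exact_mod_cast hsum
  have : (a * r : ℝ) / p + a * s / p + a * t / p = a := by
    rw [← add_div, ← add_div, ← mul_add, ← mul_add, hsum', mul_div_cancel_right₀ _ hp0]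
  rw [hw]
  push_cast
  simp only [Int.fract]
  linarith


/-- Let `p > 3` be a prime with `p ≡ 3 (mod 4)`, `k = ℚ(√-p) ⊆ ℂ` (via the embedding sending
`√-p` to `i√p`), and `n = (p-1)/2`. If `r, s, t` are integers with `0 < r, s, t < p` and
`r + s + t = p`, then there is a nonzero `z ∈ k` with
`∏_{(a|p)=1} B(⟨ar/p⟩, ⟨as/p⟩)
  = z · (2πi)^(-n) · ∏_{(a|p)=1} Γ(⟨ar/p⟩)·Γ(⟨as/p⟩)·Γ(⟨at/p⟩)`,
where `B(u,v) = ∫_0^1 x^(u-1)(1-x)^(v-1) dx` is Euler's beta function. -/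
theorem prod_beta_fract_eq (p : ℕ) [Fact p.Prime]
    (hp4 : p % 4 = 3) (hp : 3 < p) (n : ℕ) (hn : n = (p - 1) / 2)
    (r s t : ℕ)
    (hr0 : 0 < r) (hrp : r < p) (hs0 : 0 < s) (hsp : s < p) (ht0 : 0 < t) (htp : t < p)
    (hsum : r + s + t = p) :
    ∃ z : ℂ, z ≠ 0 ∧
      z ∈ Algebra.adjoin ℚ ({Complex.I * Real.sqrt p} : Set ℂ) ∧
      ∏ a ∈ (Finset.Icc 1 (p - 1)).filter (fun a : ℕ => legendreSym p a = 1),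
          Complex.betaIntegral ((Int.fract ((a * r : ℝ) / p) : ℝ) : ℂ)
            ((Int.fract ((a * s : ℝ) / p) : ℝ) : ℂ)
        = z * (2 * (Real.pi : ℂ) * Complex.I) ^ (-(n : ℤ)) *
            ∏ a ∈ (Finset.Icc 1 (p - 1)).filter (fun a : ℕ => legendreSym p a = 1),
              Complex.Gamma ((Int.fract ((a * r : ℝ) / p) : ℝ) : ℂ)
                * Complex.Gamma ((Int.fract ((a * s : ℝ) / p) : ℝ) : ℂ)
                * Complex.Gamma ((Int.fract ((a * t : ℝ) / p) : ℝ) : ℂ) := by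
  have hpp : p.Prime := Fact.out
  have hndvd : ∀ {b : ℕ}, 0 < b → b < p → ¬ p ∣ b := fun h0 h1 => Nat.not_dvd_of_pos_of_lt h0 h1
  have hfactor := fun (a : ℕ) (ha : ¬ p ∣ a) =>
    betaIntegral_fract_eq hpp ha (hndvd hr0 hrp) (hndvd hs0 hsp) (hndvd ht0 htp) hsum
  choose! q hq0 hq using hfactor
  have hsin := prod_residues_two_mul_sin p t hp4
    ((Nat.coprime_comm.1 ((Nat.Prime.coprime_iff_not_dvd hpp).2 (hndvd ht0 htp))))
  have hcard := card_filter_legendreSym_eq_one p hp4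
  rw [← hn] at hcard
  set S := (Finset.Icc 1 (p - 1)).filter (fun a : ℕ => legendreSym p a = 1) with hS
  have hmem : ∀ a ∈ S, ¬ p ∣ a := by
    intro a ha
    rw [hS, Finset.mem_filter, Finset.mem_Icc] at ha
    exact hndvd (by omega) (by omega)
  have hsqrt : (Real.sqrt p : ℂ) ≠ 0 := by
    exact_mod_cast (Real.sqrt_pos.2 (Nat.cast_pos.2 hpp.pos)).ne'
  refine ⟨((∏ a ∈ S, q a : ℚ) : ℂ) * (Complex.I ^ n * Real.sqrt p), ?_, ?_, ?_⟩
  · refine mul_ne_zero ?_ (mul_ne_zero (pow_ne_zero _ Complex.I_ne_zero) hsqrt)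
    exact_mod_cast Finset.prod_ne_zero_iff.2 fun a ha => hq0 a (hmem a ha)
  · have hI : Complex.I ^ n * Real.sqrt p =
        (((-1) ^ (n / 2) : ℚ) : ℂ) * (Complex.I * Real.sqrt p) := by
      have hodd : n = 2 * (n / 2) + 1 := by omega
      conv_lhs => rw [hodd, pow_succ, pow_mul, Complex.I_sq]
      push_cast
      ring
    rw [hI]
    refine mul_mem (Subalgebra.algebraMap_mem _ (∏ a ∈ S, q a : ℚ)) (mul_mem
      (Subalgebra.algebraMap_mem _ ((-1) ^ (n / 2) : ℚ)) (Algebra.subset_adjoin rfl))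
  · have hpi : (Real.pi : ℂ) ≠ 0 := by exact_mod_cast Real.pi_ne_zero
    rw [Finset.prod_congr rfl fun a ha => hq a (hmem a ha), Finset.prod_mul_distrib,
      Finset.prod_mul_distrib, Finset.prod_div_distrib, Finset.prod_const, hcard, ← hsin,
      Finset.prod_mul_distrib (f := fun _ => (2 : ℝ)), Finset.prod_const, hcard]
    congr 1
    push_cast
    rw [zpow_neg, zpow_natCast, mul_pow, mul_pow]
    generalize ∏ a ∈ S, Complex.sin (Real.pi * (Int.fract ((a * t : ℝ) / p) : ℝ)) = σ
    field_simp
end
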